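/- arXiv:2304.04204 — 6 statements merged into one kernel-verified Lean document; each statement's English description precedes it below -/
import Mathlib

section
/- Let v : ℝ² → ℂ be continuously differentiable, α-quasiperiodic, and vanish on the set {x₂ ≤ f(x₁)} (so v extends by zero below the grating). For n ∈ ℤ let v_n(R) = (1/2π)∫₀^{2π} v(x₁,R) e^{−i α_n x₁} dx₁. Then 2π · Σ_{n∈ℤ} (k² + α_n²)^{1/2} |v_n(R)|² ≤ k²‖v‖²_{L²(Ω_R)} + ‖∇v‖²_{L²(Ω_R)}. Equivalently, √(2π)·‖v‖_{H^{1/2}_α(Γ_R)} ≤ ‖v‖_{X_R}, where ‖v‖²_{H^{1/2}_α(Γ_R)} = Σ_n (k²+α_n²)^{1/2}|v_n(R)|². -/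
open MeasureTheory Real Set

noncomputable section

/-- Partial derivative in the `x₁` direction. -/
def p1 (u : ℝ × ℝ → ℂ) (x : ℝ × ℝ) : ℂ := fderiv ℝ u x (1, 0)

/-- Partial derivative in the `x₂` direction. -/
def p2 (u : ℝ × ℝ → ℂ) (x : ℝ × ℝ) : ℂ := fderiv ℝ u x (0, 1)

/-- Laplacian of a function on `ℝ²`. -/
def lap (u : ℝ × ℝ → ℂ) (x : ℝ × ℝ) : ℂ := p1 (p1 u) x + p2 (p2 u) x

/-- The coefficients `β_n`: `β_n = √(k² − (n+α)²)` if `|n+α| ≤ k`, `β_n = i√((n+α)² − k²)`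
otherwise. -/
def betan (k α : ℝ) (n : ℤ) : ℂ :=
  if |(n : ℝ) + α| ≤ k then ((Real.sqrt (k ^ 2 - ((n : ℝ) + α) ^ 2) : ℝ) : ℂ)
  else Complex.I * ((Real.sqrt (((n : ℝ) + α) ^ 2 - k ^ 2) : ℝ) : ℂ)

/-- `α`-quasiperiodicity: `u(x₁ + 2π, x₂) = e^{2πiα} u(x₁, x₂)`. -/
def QP (α : ℝ) (u : ℝ × ℝ → ℂ) : Prop :=
  ∀ x : ℝ × ℝ, u (x.1 + 2 * π, x.2) = Complex.exp (((2 * π * α : ℝ) : ℂ) * Complex.I) * u x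

/-- `Γ_max = max_{0 ≤ t ≤ 2π} f(t)`. -/
def GammaMax (f : ℝ → ℝ) : ℝ := sSup (f '' Icc 0 (2 * π))

/-- `Γ_min = min_{0 ≤ t ≤ 2π} f(t)`. -/
def GammaMin (f : ℝ → ℝ) : ℝ := sInf (f '' Icc 0 (2 * π))

/-- The truncated periodic cell `Ω_R = {(x₁,x₂) : f(x₁) < x₂ < R, 0 < x₁ < 2π}`. -/
def OmegaR (f : ℝ → ℝ) (R : ℝ) : Set (ℝ × ℝ) :=
  {x | 0 < x.1 ∧ x.1 < 2 * π ∧ f x.1 < x.2 ∧ x.2 < R}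

/-- The incident plane wave `u^i(x) = γ e^{i(αx₁ − βx₂)}`, `α = k sin θ`, `β = k cos θ`. -/
def ui (k θ : ℝ) (γ : ℂ) (x : ℝ × ℝ) : ℂ :=
  γ * Complex.exp (Complex.I * ((k * Real.sin θ * x.1 - k * Real.cos θ * x.2 : ℝ) : ℂ))

/-- The upward (outgoing) Rayleigh series `Σₙ cₙ e^{i(αₙ x₁ + βₙ x₂)}` with `αₙ = n + α`. -/
def ray (k α : ℝ) (c : ℤ → ℂ) (x : ℝ × ℝ) : ℂ :=
  ∑' n : ℤ, c n * Complex.exp (Complex.I * ((((n : ℝ) + α) * x.1 : ℝ) : ℂ)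
    + Complex.I * betan k α n * (x.2 : ℂ))

/-- The normal derivative `∂_ν u` on the grating profile `Γ`, with
`ν = (−f′(x₁), 1)/√(1 + f′(x₁)²)`. -/
def dnu (f : ℝ → ℝ) (u : ℝ × ℝ → ℂ) (x₁ : ℝ) : ℂ :=
  (((-(deriv f x₁) : ℝ) : ℂ) * p1 u (x₁, f x₁) + p2 u (x₁, f x₁)) /
    ((Real.sqrt (1 + (deriv f x₁) ^ 2) : ℝ) : ℂ)

/-- The squared energy norm `‖u‖²_{X_R} = k²‖u‖²_{L²(Ω_R)} + ‖∇u‖²_{L²(Ω_R)}`. -/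
def XRnorm2 (k : ℝ) (f : ℝ → ℝ) (R : ℝ) (u : ℝ × ℝ → ℂ) : ℝ :=
  k ^ 2 * (∫ x in OmegaR f R, ‖u x‖ ^ 2) + ∫ x in OmegaR f R, (‖p1 u x‖ ^ 2 + ‖p2 u x‖ ^ 2)

/-- The Fourier coefficient of `g` over one period with frequency `a`. -/
def periodCoeff (a : ℝ) (g : ℝ → ℂ) : ℂ :=
  ((1 / (2 * π) : ℝ) : ℂ) *
    ∫ x in (0 : ℝ)..(2 * π), g x * Complex.exp (-(Complex.I) * ((a * x : ℝ) : ℂ))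

/-- Bessel's inequality for the frequencies `n + α`. -/
theorem sum_norm_sq_periodCoeff_le (α : ℝ) {g : ℝ → ℂ} (hg : Continuous g) (S : Finset ℤ) :
    2 * π * ∑ n ∈ S, ‖periodCoeff ((n : ℝ) + α) g‖ ^ 2 ≤
      ∫ x in (0 : ℝ)..(2 * π), ‖g x‖ ^ 2 := by
  have hpi : (0 : ℝ) < 2 * π := by positivity
  set h : ℝ → ℂ := fun x => g x * Complex.exp (-(Complex.I) * ((α * x : ℝ) : ℂ)) with hh
  have hc : Continuous h := by fun_prop
  have hnorm (x : ℝ) : ‖h x‖ = ‖g x‖ := by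
    have : -(Complex.I) * ((α * x : ℝ) : ℂ) = ((-(α * x) : ℝ) : ℂ) * Complex.I := by
      push_cast; ring
    simp only [hh, norm_mul, this, Complex.norm_exp_ofReal_mul_I, mul_one]
  have hmem : MemLp h 2 (volume.restrict (Ioc 0 (2 * π))) := by
    obtain ⟨C, hC⟩ := (isCompact_Icc (a := (0 : ℝ)) (b := 2 * π)).exists_bound_of_continuousOn
      hc.continuousOn
    refine MemLp.of_bound hc.aestronglyMeasurable C ?_
    filter_upwards [ae_restrict_mem measurableSet_Ioc] with x hx using hC x (Ioc_subset_Icc_self hx)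
  have hcoeff (n : ℤ) : fourierCoeffOn hpi h n = periodCoeff ((n : ℝ) + α) g := by
    rw [fourierCoeffOn_eq_integral, periodCoeff, Complex.real_smul, sub_zero]
    congr 1
    refine intervalIntegral.integral_congr fun x _ => ?_
    simp only [smul_eq_mul, fourier_coe_apply, hh]
    rw [mul_left_comm, ← Complex.exp_add]
    congr 2
    push_cast
    field_simp
    ring
  have hs := hasSum_sq_fourierCoeffOn hpi hmem
  have hle := sum_le_hasSum S (fun n _ => by positivity) hs
  simp only [hcoeff, hnorm, sub_zero, smul_eq_mul] at hle
  calc _ ≤ 2 * π * ((2 * π)⁻¹ * ∫ x in (0 : ℝ)..(2 * π), ‖g x‖ ^ 2) := by gcongr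
    _ = _ := by field_simp

/-- Integration by parts for quasiperiodic functions: no boundary terms. -/
theorem periodCoeff_deriv {a : ℝ} {g g' : ℝ → ℂ} (hg : ∀ x, HasDerivAt g (g' x) x)
    (hg' : Continuous g')
    (hqp : g (2 * π) = Complex.exp (((2 * π * a : ℝ) : ℂ) * Complex.I) * g 0) :
    periodCoeff a g' = Complex.I * a * periodCoeff a g := by
  set e : ℝ → ℂ := fun x => Complex.exp (-(Complex.I) * ((a * x : ℝ) : ℂ)) with he
  have hde (x : ℝ) : HasDerivAt e (-(Complex.I) * a * e x) x := by
    have h1 : HasDerivAt (fun x : ℝ => ((a * x : ℝ) : ℂ)) (a : ℂ) x := by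
      simpa using ((hasDerivAt_id x).const_mul a).ofReal_comp
    simpa [he, mul_comm, mul_left_comm] using (h1.const_mul (-(Complex.I))).cexp
  have hce : Continuous e := by fun_prop
  have hparts := intervalIntegral.integral_mul_deriv_eq_deriv_mul
    (a := 0) (b := 2 * π) (fun x _ => hg x) (fun x _ => hde x)
    (hg'.intervalIntegrable _ _) ((by fun_prop : Continuous _).intervalIntegrable _ _)
  have hbd : g (2 * π) * e (2 * π) = g 0 * e 0 := by
    rw [hqp, mul_right_comm, he]
    simp only []
    rw [← Complex.exp_add]
    have : ((2 * π * a : ℝ) : ℂ) * Complex.I + -(Complex.I) * ((a * (2 * π) : ℝ) : ℂ) = 0 := by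
      push_cast; ring
    rw [this]; simp
  have hl : ∫ x in (0 : ℝ)..(2 * π), g x * (-(Complex.I) * a * e x) =
      -(Complex.I) * a * ∫ x in (0 : ℝ)..(2 * π), g x * e x := by
    rw [← intervalIntegral.integral_const_mul]
    congr 1; ext x; ring
  rw [hbd, hl, sub_self, zero_sub] at hparts
  simp only [periodCoeff]
  linear_combination ((1 / (2 * π) : ℝ) : ℂ) * hparts

theorem hasDerivAt_prodMk_right {v : ℝ × ℝ → ℂ} (hv : ContDiff ℝ 1 v) (x s : ℝ) :
    HasDerivAt (fun t => v (x, t)) (p2 v (x, s)) s := by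
  have h := (hv.differentiable one_ne_zero (x, s)).hasFDerivAt
  exact h.comp_hasDerivAt s ((hasDerivAt_const s x).prodMk (hasDerivAt_id s))

theorem hasDerivAt_prodMk_left {v : ℝ × ℝ → ℂ} (hv : ContDiff ℝ 1 v) (x s : ℝ) :
    HasDerivAt (fun t => v (t, s)) (p1 v (x, s)) x := by
  have h := (hv.differentiable one_ne_zero (x, s)).hasFDerivAt
  exact h.comp_hasDerivAt x ((hasDerivAt_id x).prodMk (hasDerivAt_const x s))

theorem continuous_p1 {v : ℝ × ℝ → ℂ} (hv : ContDiff ℝ 1 v) : Continuous (p1 v) :=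
  (hv.continuous_fderiv one_ne_zero).clm_apply continuous_const

theorem continuous_p2 {v : ℝ × ℝ → ℂ} (hv : ContDiff ℝ 1 v) : Continuous (p2 v) :=
  (hv.continuous_fderiv one_ne_zero).clm_apply continuous_const

theorem continuous_periodCoeff (a : ℝ) {v : ℝ × ℝ → ℂ} (hv : Continuous v) :
    Continuous fun s => periodCoeff a fun x => v (x, s) := by
  unfold periodCoeff
  refine continuous_const.mul
    (intervalIntegral.continuous_parametric_intervalIntegral_of_continuous' ?_ _ _)
  simp only [Function.uncurry_def]
  fun_prop

theorem hasDerivAt_periodCoeff (a : ℝ) {v : ℝ × ℝ → ℂ} (hv : ContDiff ℝ 1 v) (s : ℝ) :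
    HasDerivAt (fun s => periodCoeff a fun x => v (x, s))
      (periodCoeff a fun x => p2 v (x, s)) s := by
  have hc := hv.continuous
  have hc2 := continuous_p2 hv
  obtain ⟨C, hC⟩ := (isCompact_Icc (a := ((0 : ℝ), s - 1))
    (b := (2 * π, s + 1))).exists_bound_of_continuousOn
    (f := fun y : ℝ × ℝ => p2 v y * Complex.exp (-(Complex.I) * ((a * y.1 : ℝ) : ℂ)))
    (by fun_prop)
  refine HasDerivAt.const_mul _ (intervalIntegral.hasDerivAt_integral_of_dominated_loc_of_deriv_le
    (F := fun s x => v (x, s) * Complex.exp (-(Complex.I) * ((a * x : ℝ) : ℂ)))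
    (F' := fun s x => p2 v (x, s) * Complex.exp (-(Complex.I) * ((a * x : ℝ) : ℂ)))
    (bound := fun _ => C)
    (Icc_mem_nhds (by linarith : s - 1 < s) (by linarith : s < s + 1)) ?_ ?_ ?_ ?_ ?_ ?_).2
  · exact .of_forall fun t => (by fun_prop : Continuous _).aestronglyMeasurable
  · exact (by fun_prop : Continuous _).intervalIntegrable _ _
  · exact (by fun_prop : Continuous _).aestronglyMeasurable
  · refine .of_forall fun x hx t ht => ?_
    rw [uIoc_of_le (by positivity)] at hx
    exact hC (x, t) ⟨⟨hx.1.le, ht.1⟩, ⟨hx.2, ht.2⟩⟩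
  · exact intervalIntegrable_const
  · exact .of_forall fun x _ t _ => (hasDerivAt_prodMk_right hv x t).mul_const _

/-- A one-dimensional trace estimate for functions vanishing at the left end point. -/
theorem mul_norm_sq_le_integral {c c' : ℝ → ℂ} (hc : ∀ s, HasDerivAt c (c' s) s)
    (hc' : Continuous c') {l r : ℝ} (hlr : l ≤ r) (h0 : c l = 0) (b : ℝ) :
    b * ‖c r‖ ^ 2 ≤ ∫ s in l..r, (b ^ 2 * ‖c s‖ ^ 2 + ‖c' s‖ ^ 2) := by
  have hcc : Continuous c := continuous_iff_continuousAt.2 fun s => (hc s).continuousAt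
  have hd (s : ℝ) : HasDerivAt (fun s => b * ‖c s‖ ^ 2) (b * (2 * inner ℝ (c s) (c' s))) s :=
    (hc s).norm_sq.const_mul b
  have hint := intervalIntegral.integral_eq_sub_of_hasDerivAt (a := l) (b := r)
    (fun s _ => hd s) ((by fun_prop : Continuous _).intervalIntegrable _ _)
  have h : b * ‖c r‖ ^ 2 = ∫ s in l..r, b * (2 * inner ℝ (c s) (c' s)) := by
    rw [hint, h0]; simp
  rw [h]
  refine intervalIntegral.integral_mono_on hlr
    ((by fun_prop : Continuous _).intervalIntegrable _ _)
    ((by fun_prop : Continuous _).intervalIntegrable _ _) fun s _ => ?_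
  have h1 := norm_sub_sq_real (b • c s) (c' s)
  rw [norm_smul, mul_pow, Real.norm_eq_abs, sq_abs, real_inner_smul_left] at h1
  nlinarith [sq_nonneg ‖b • c s - c' s‖]

/-- The derivative of a `C¹` function vanishing on the closed region below a continuous graph
vanishes there, including on the graph itself. -/
theorem fderiv_eq_zero_of_le_graph {f : ℝ → ℝ} (hf : Continuous f) {v : ℝ × ℝ → ℂ}
    (hv : ContDiff ℝ 1 v) (hv0 : ∀ x : ℝ × ℝ, x.2 ≤ f x.1 → v x = 0) {x : ℝ × ℝ}
    (hx : x.2 ≤ f x.1) : fderiv ℝ v x = 0 := by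
  have hopen : IsOpen {y : ℝ × ℝ | y.2 < f y.1} :=
    isOpen_lt continuous_snd (hf.comp continuous_fst)
  have hbelow (t : ℝ) (ht : t < x.2) : fderiv ℝ v (x.1, t) = 0 := by
    have : v =ᶠ[nhds (x.1, t)] fun _ => 0 := by
      filter_upwards [hopen.mem_nhds (show (x.1, t) ∈ {y : ℝ × ℝ | y.2 < f y.1} from
        ht.trans_le hx)] with y hy using hv0 y (le_of_lt hy)
    rw [this.fderiv_eq]; simp
  have hcont : Continuous fun t : ℝ => fderiv ℝ v (x.1, t) :=
    (hv.continuous_fderiv one_ne_zero).comp (by fun_prop)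
  have hmem : x.2 ∈ closure (Iio x.2) := by rw [closure_Iio]; exact self_mem_Iic
  exact (isClosed_eq hcont continuous_const).closure_subset_iff.2 hbelow hmem

/-- The energy over the cell as an iterated integral over a rectangle containing it. -/
theorem integral_rectangle_eq_XRnorm2 {f : ℝ → ℝ} (hf : Continuous f) {l R : ℝ}
    (hl : ∀ t, l < f t) (hlR : l ≤ R) (k : ℝ) {v : ℝ × ℝ → ℂ} (hv : ContDiff ℝ 1 v)
    (hv0 : ∀ x : ℝ × ℝ, x.2 ≤ f x.1 → v x = 0) :
    ∫ s in l..R, ∫ x in (0 : ℝ)..(2 * π),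
      (k ^ 2 * ‖v (x, s)‖ ^ 2 + ‖p1 v (x, s)‖ ^ 2 + ‖p2 v (x, s)‖ ^ 2) = XRnorm2 k f R v := by
  have hc := hv.continuous
  have hc1 := continuous_p1 hv
  have hc2 := continuous_p2 hv
  have hpi : (0 : ℝ) ≤ 2 * π := by positivity
  have hsub : OmegaR f R ⊆ Ioo 0 (2 * π) ×ˢ Ioo l R := fun x hx =>
    ⟨⟨hx.1, hx.2.1⟩, ⟨(hl _).trans hx.2.2.1, hx.2.2.2⟩⟩
  have hint {g : ℝ × ℝ → ℝ} (hg : Continuous g) :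
      IntegrableOn g (Ioo 0 (2 * π) ×ˢ Ioo l R) := by
    refine (hg.continuousOn.integrableOn_compact (isCompact_Icc.prod isCompact_Icc)).mono_set
      (prod_mono Ioo_subset_Icc_self Ioo_subset_Icc_self)
  set F : ℝ × ℝ → ℝ := fun y => k ^ 2 * ‖v y‖ ^ 2 + ‖p1 v y‖ ^ 2 + ‖p2 v y‖ ^ 2 with hF
  have hFc : Continuous F := by fun_prop
  have hX : XRnorm2 k f R v = ∫ y in OmegaR f R, F y := by
    rw [XRnorm2, ← integral_const_mul, ← integral_add]
    · simp only [hF, add_assoc]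
    · exact (hint (by fun_prop)).mono_set hsub
    · exact (hint (by fun_prop)).mono_set hsub
  have hrect : ∫ y in OmegaR f R, F y = ∫ y in Ioo 0 (2 * π) ×ˢ Ioo l R, F y := by
    refine (setIntegral_eq_of_subset_of_forall_sdiff_eq_zero
      (measurableSet_Ioo.prod measurableSet_Ioo) hsub fun y hy => ?_).symm
    have hle : y.2 ≤ f y.1 := by
      by_contra! hlt
      exact hy.2 ⟨hy.1.1.1, hy.1.1.2, hlt, hy.1.2.2⟩
    simp [hF, p1, p2, hv0 y hle, fderiv_eq_zero_of_le_graph hf hv hv0 hle]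
  rw [hX, hrect, Measure.volume_eq_prod, ← setIntegral_prod_swap, setIntegral_prod,
    intervalIntegral.integral_of_le hlR, integral_Ioc_eq_integral_Ioo]
  · simp only [intervalIntegral.integral_of_le hpi, integral_Ioc_eq_integral_Ioo, Prod.swap_prod_mk,
      hF]
  · exact ((hFc.comp continuous_swap).continuousOn.integrableOn_compact
      (isCompact_Icc.prod isCompact_Icc)).mono_set
      (prod_mono Ioo_subset_Icc_self Ioo_subset_Icc_self)

/-- Lemma 3.3 of the paper: the trace estimate
`√(2π)‖v‖_{H^{1/2}_α(Γ_R)} ≤ ‖v‖_{X_R}` for `C¹`, `α`-quasiperiodic functions vanishing below the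
grating profile, where `v_n(R)` are the Fourier coefficients of the trace `v(·,R)`. -/
theorem trace_estimate_half_norm
    (f : ℝ → ℝ) (hfper : ∀ t, f (t + 2 * π) = f t)
    (L : NNReal) (hflip : LipschitzWith L f)
    (fm : ℝ) (hfm : ∀ t, fm < f t)
    (k α : ℝ) (hk : 0 < k)
    (R : ℝ) (hR : GammaMax f < R)
    (v : ℝ × ℝ → ℂ) (hv : ContDiff ℝ 1 v) (hvqp : QP α v)
    (hv0 : ∀ x : ℝ × ℝ, x.2 ≤ f x.1 → v x = 0)
    (vn : ℤ → ℂ)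
    (hvn : ∀ n : ℤ, vn n = ((1 / (2 * π) : ℝ) : ℂ) *
        ∫ x₁ in (0 : ℝ)..(2 * π), v (x₁, R) *
          Complex.exp (-(Complex.I) * ((((n : ℝ) + α) * x₁ : ℝ) : ℂ))) :
    2 * π * ∑' n : ℤ, Real.sqrt (k ^ 2 + ((n : ℝ) + α) ^ 2) * ‖vn n‖ ^ 2 ≤
      XRnorm2 k f R v := by
  have hpi : (0 : ℝ) ≤ 2 * π := by positivity
  have hc := hv.continuous
  have hc1 := continuous_p1 hv
  have hc2 := continuous_p2 hv
  have hlR : fm ≤ R := by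
    have : f 0 ≤ GammaMax f := le_csSup
      (isCompact_Icc.image hflip.continuous).bddAbove (mem_image_of_mem f ⟨le_rfl, hpi⟩)
    linarith [hfm 0]
  have hvn' (n : ℤ) : vn n = periodCoeff ((n : ℝ) + α) fun x => v (x, R) := hvn n
  have hp1 (n : ℤ) (s : ℝ) : ‖periodCoeff ((n : ℝ) + α) fun x => p1 v (x, s)‖ ^ 2 =
      ((n : ℝ) + α) ^ 2 * ‖periodCoeff ((n : ℝ) + α) fun x => v (x, s)‖ ^ 2 := by
    rw [periodCoeff_deriv (g := fun x => v (x, s)) (fun x => hasDerivAt_prodMk_left hv x s)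
      (by fun_prop)]
    · simp only [norm_mul, Complex.norm_I, Complex.norm_real, Real.norm_eq_abs, one_mul, mul_pow,
        sq_abs]
    · have h := hvqp (0, s)
      simp only [zero_add] at h
      rw [h]
      congr 1
      refine Complex.exp_eq_exp_iff_exists_int.2 ⟨-n, ?_⟩
      push_cast; ring
  have hmode (n : ℤ) : Real.sqrt (k ^ 2 + ((n : ℝ) + α) ^ 2) * ‖vn n‖ ^ 2 ≤
      ∫ s in fm..R, (k ^ 2 * ‖periodCoeff ((n : ℝ) + α) fun x => v (x, s)‖ ^ 2 +
        ‖periodCoeff ((n : ℝ) + α) fun x => p1 v (x, s)‖ ^ 2 +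
        ‖periodCoeff ((n : ℝ) + α) fun x => p2 v (x, s)‖ ^ 2) := by
    have h0 : (periodCoeff ((n : ℝ) + α) fun x => v (x, fm)) = 0 := by
      simp [periodCoeff, fun x => hv0 (x, fm) (hfm x).le]
    have h := mul_norm_sq_le_integral (hasDerivAt_periodCoeff ((n : ℝ) + α) hv)
      (continuous_periodCoeff _ hc2) hlR h0 (Real.sqrt (k ^ 2 + ((n : ℝ) + α) ^ 2))
    rw [Real.sq_sqrt (by positivity)] at h
    simpa only [hvn', hp1, add_mul] using h
  have hcoeff {w : ℝ × ℝ → ℂ} (hw : Continuous w) (n : ℤ) :=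
    continuous_periodCoeff ((n : ℝ) + α) hw
  rw [← integral_rectangle_eq_XRnorm2 hflip.continuous hfm hlR k hv hv0, ← tsum_mul_left]
  refine Real.tsum_le_of_sum_le (fun n => by positivity) fun S => ?_
  rw [← Finset.mul_sum]
  have hI (n : ℤ) : Continuous fun s =>
      k ^ 2 * ‖periodCoeff ((n : ℝ) + α) fun x => v (x, s)‖ ^ 2 +
        ‖periodCoeff ((n : ℝ) + α) fun x => p1 v (x, s)‖ ^ 2 +
        ‖periodCoeff ((n : ℝ) + α) fun x => p2 v (x, s)‖ ^ 2 := by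
    have := hcoeff hc n
    have := hcoeff hc1 n
    have := hcoeff hc2 n
    fun_prop
  refine (mul_le_mul_of_nonneg_left (Finset.sum_le_sum fun n _ => hmode n) hpi).trans ?_
  rw [← intervalIntegral.integral_finsetSum fun n _ => (hI n).intervalIntegrable _ _,
    ← intervalIntegral.integral_const_mul]
  refine intervalIntegral.integral_mono_on hlR
    ((continuous_const.mul (continuous_finsetSum _ fun n _ => hI n)).intervalIntegrable _ _)
    (Continuous.intervalIntegrable
      (intervalIntegral.continuous_parametric_intervalIntegral_of_continuous'
        (by simp only [Function.uncurry_def]; fun_prop) _ _) _ _) fun s _ => ?_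
  have b0 := sum_norm_sq_periodCoeff_le α (g := fun x => v (x, s)) (by fun_prop) S
  have b1 := sum_norm_sq_periodCoeff_le α (g := fun x => p1 v (x, s)) (by fun_prop) S
  have b2 := sum_norm_sq_periodCoeff_le α (g := fun x => p2 v (x, s)) (by fun_prop) S
  rw [intervalIntegral.integral_add, intervalIntegral.integral_add,
    intervalIntegral.integral_const_mul, Finset.sum_add_distrib, Finset.sum_add_distrib,
    ← Finset.mul_sum]
  · linarith [mul_le_mul_of_nonneg_left b0 (sq_nonneg k)]
  all_goals exact (by fun_prop : Continuous _).intervalIntegrable _ _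
end
end

section
/- For every v ∈ H¹(Ω_R) (it suffices to prove this for v continuously differentiable on the closure of Ω_R), one has ‖v‖²_{L²(Ω_R)} ≤ (R−f₋)²·‖∂v/∂x₂‖²_{L²(Ω_R)} + 2(R−f₋)·‖v‖²_{L²(Γ)}. -/
open MeasureTheory Real Set

noncomputable section

theorem sq_intervalIntegral_le {φ : ℝ → ℝ} (hφ : Continuous φ) {a t : ℝ} (hat : a ≤ t) :
    (∫ x in a..t, φ x) ^ 2 ≤ (t - a) * ∫ x in a..t, φ x ^ 2 := by
  rcases hat.eq_or_lt with rfl | hlt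
  · simp
  have hpos : 0 < t - a := sub_pos.2 hlt
  set m : ℝ := (∫ x in a..t, φ x) / (t - a) with hm
  have hmI : ∫ x in a..t, φ x = m * (t - a) := by rw [hm]; field_simp
  have hnn : 0 ≤ ∫ x in a..t, (φ x - m) ^ 2 :=
    intervalIntegral.integral_nonneg hat fun x _ => sq_nonneg _
  have hexp : ∫ x in a..t, (φ x - m) ^ 2
      = (∫ x in a..t, φ x ^ 2) - 2 * m * (∫ x in a..t, φ x) + m ^ 2 * (t - a) := by
    have h1 : ∀ x, (φ x - m) ^ 2 = φ x ^ 2 - 2 * m * φ x + m ^ 2 := fun x => by ring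
    simp only [h1]
    rw [intervalIntegral.integral_add
        (Continuous.intervalIntegrable (by fun_prop) _ _)
        (Continuous.intervalIntegrable (by fun_prop) _ _),
      intervalIntegral.integral_sub
        (Continuous.intervalIntegrable (by fun_prop) _ _)
        (Continuous.intervalIntegrable (by fun_prop) _ _),
      intervalIntegral.integral_const_mul, intervalIntegral.integral_const, smul_eq_mul]
    ring
  rw [hexp, hmI] at hnn
  rw [hmI]
  nlinarith [mul_nonneg hpos.le hnn]

theorem norm_sq_le_of_hasDerivAt {g g' : ℝ → ℂ} (hg : ∀ t, HasDerivAt g (g' t) t)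
    (hg' : Continuous g') {a b t : ℝ} (hat : a ≤ t) (htb : t ≤ b) :
    ‖g t‖ ^ 2 ≤ 2 * ‖g a‖ ^ 2 + 2 * (t - a) * ∫ x in a..b, ‖g' x‖ ^ 2 := by
  have hftc : ∫ x in a..t, g' x = g t - g a :=
    intervalIntegral.integral_eq_sub_of_hasDerivAt (fun x _ => hg x)
      (hg'.intervalIntegrable _ _)
  have h1 : ‖g t - g a‖ ≤ ∫ x in a..t, ‖g' x‖ :=
    hftc ▸ intervalIntegral.norm_integral_le_integral_norm hat
  have h2 : ‖g t - g a‖ ^ 2 ≤ (t - a) * ∫ x in a..t, ‖g' x‖ ^ 2 :=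
    (pow_le_pow_left₀ (norm_nonneg _) h1 2).trans (sq_intervalIntegral_le hg'.norm hat)
  have h3 : ∫ x in a..t, ‖g' x‖ ^ 2 ≤ ∫ x in a..b, ‖g' x‖ ^ 2 :=
    intervalIntegral.integral_mono_interval le_rfl hat htb
      (Filter.Eventually.of_forall fun x => sq_nonneg _)
      (Continuous.intervalIntegrable (by fun_prop) _ _)
  have h4 : ‖g t‖ ≤ ‖g a‖ + ‖g t - g a‖ := by
    simpa using norm_add_le (g a) (g t - g a)
  nlinarith [mul_le_mul_of_nonneg_left h3 (sub_nonneg.2 hat), norm_nonneg (g t),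
    sq_nonneg (‖g a‖ - ‖g t - g a‖), pow_le_pow_left₀ (norm_nonneg _) h4 2]

theorem setIntegral_Ioo_norm_sq_le {g g' : ℝ → ℂ} (hg : ∀ t, HasDerivAt g (g' t) t)
    (hg' : Continuous g') {a b : ℝ} (hab : a ≤ b) :
    ∫ t in Ioo a b, ‖g t‖ ^ 2 ≤
      (b - a) ^ 2 * (∫ t in Ioo a b, ‖g' t‖ ^ 2) + 2 * (b - a) * ‖g a‖ ^ 2 := by
  have hgc : Continuous g := continuous_iff_continuousAt.2 fun t => (hg t).continuousAt
  simp only [← integral_Ioc_eq_integral_Ioo, ← intervalIntegral.integral_of_le hab]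
  set D := ∫ t in a..b, ‖g' t‖ ^ 2
  have hmono : ∫ t in a..b, ‖g t‖ ^ 2 ≤ ∫ t in a..b, (2 * ‖g a‖ ^ 2 + 2 * (t - a) * D) :=
    intervalIntegral.integral_mono_on hab
      (Continuous.intervalIntegrable (by fun_prop) _ _)
      (Continuous.intervalIntegrable (by fun_prop) _ _)
      fun t ht => norm_sq_le_of_hasDerivAt hg hg' ht.1 ht.2
  refine hmono.trans (le_of_eq ?_)
  have hF : ∀ t ∈ uIcc a b, HasDerivAt (fun t => 2 * ‖g a‖ ^ 2 * t + (t - a) ^ 2 * D)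
      (2 * ‖g a‖ ^ 2 + 2 * (t - a) * D) t := fun t _ => by
    have h := ((hasDerivAt_id t).const_mul (2 * ‖g a‖ ^ 2)).add
      ((((hasDerivAt_id t).sub_const a).pow 2).mul_const D)
    exact h.congr_deriv (by simp)
  rw [intervalIntegral.integral_eq_sub_of_hasDerivAt hF
    (Continuous.intervalIntegrable (by fun_prop) _ _)]
  ring

theorem isOpen_omegaR {f : ℝ → ℝ} (hf : Continuous f) (R : ℝ) : IsOpen (OmegaR f R) :=
  (isOpen_lt continuous_const continuous_fst).inter <|
    (isOpen_lt continuous_fst continuous_const).inter <|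
      (isOpen_lt (hf.comp continuous_fst) continuous_snd).inter
        (isOpen_lt continuous_snd continuous_const)

theorem integrableOn_omegaR {f : ℝ → ℝ} {fm : ℝ} (hfm : ∀ t, fm < f t) {R : ℝ}
    {h : ℝ × ℝ → ℝ} (hh : Continuous h) : IntegrableOn h (OmegaR f R) :=
  (hh.continuousOn.integrableOn_compact
    (isCompact_Icc.prod isCompact_Icc : IsCompact (Icc 0 (2 * π) ×ˢ Icc fm R))).mono_set
    fun x hx => ⟨⟨hx.1.le, hx.2.1.le⟩, ⟨(hfm x.1).le.trans hx.2.2.1.le, hx.2.2.2.le⟩⟩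

theorem integral_indicator_omegaR_section {f : ℝ → ℝ} {R : ℝ} (h : ℝ × ℝ → ℝ) (x : ℝ) :
    ∫ y, (OmegaR f R).indicator h (x, y) =
      (Ioo 0 (2 * π)).indicator (fun x => ∫ y in Ioo (f x) R, h (x, y)) x := by
  by_cases hx : x ∈ Ioo 0 (2 * π)
  · rw [indicator_of_mem hx, ← integral_indicator measurableSet_Ioo]
    congr 1
    ext y
    have hiff : (x, y) ∈ OmegaR f R ↔ y ∈ Ioo (f x) R :=
      ⟨fun h => h.2.2, fun h => ⟨hx.1, hx.2, h⟩⟩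
    by_cases hy : y ∈ Ioo (f x) R
    · rw [indicator_of_mem hy, indicator_of_mem (hiff.2 hy)]
    · rw [indicator_of_notMem hy, indicator_of_notMem (mt hiff.1 hy)]
  · rw [indicator_of_notMem hx]
    have hz : ∀ y, (OmegaR f R).indicator h (x, y) = 0 := fun y =>
      indicator_of_notMem (fun hm => hx ⟨hm.1, hm.2.1⟩) _
    simp [hz]

theorem integrableOn_integral_section {f : ℝ → ℝ} (hf : Continuous f) {fm : ℝ}
    (hfm : ∀ t, fm < f t) {R : ℝ} {h : ℝ × ℝ → ℝ} (hh : Continuous h) :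
    IntegrableOn (fun x => ∫ y in Ioo (f x) R, h (x, y)) (Ioo 0 (2 * π)) := by
  have hI := (integrableOn_omegaR (R := R) hfm hh).integrable_indicator
    (isOpen_omegaR hf R).measurableSet
  have := Integrable.integral_prod_left hI
  simp only [integral_indicator_omegaR_section] at this
  exact (integrable_indicator_iff measurableSet_Ioo).1 this

theorem setIntegral_omegaR {f : ℝ → ℝ} (hf : Continuous f) {fm : ℝ}
    (hfm : ∀ t, fm < f t) {R : ℝ} {h : ℝ × ℝ → ℝ} (hh : Continuous h) :
    ∫ x in OmegaR f R, h x = ∫ x in Ioo 0 (2 * π), ∫ y in Ioo (f x) R, h (x, y) := by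
  have hI := (integrableOn_omegaR (R := R) hfm hh).integrable_indicator
    (isOpen_omegaR hf R).measurableSet
  rw [← integral_indicator (isOpen_omegaR hf R).measurableSet,
    ← integral_indicator measurableSet_Ioo]
  refine (integral_prod _ hI).trans ?_
  simp only [integral_indicator_omegaR_section]

theorem lt_of_gammaMax_lt {f : ℝ → ℝ} (hf : Continuous f) {R : ℝ} (hR : GammaMax f < R)
    {x : ℝ} (hx : x ∈ Icc 0 (2 * π)) : f x < R :=
  (le_csSup (isCompact_Icc.image hf).bddAbove (mem_image_of_mem f hx)).trans_lt hR

theorem integrableOn_mul_arclength {f : ℝ → ℝ} {L : NNReal} (hf : LipschitzWith L f)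
    {q : ℝ → ℝ} (hq : Continuous q) (a b : ℝ) :
    IntegrableOn (fun x => q x * √(1 + deriv f x ^ 2)) (Ioo a b) := by
  have hqI : IntegrableOn q (Ioo a b) :=
    (hq.continuousOn.integrableOn_compact isCompact_Icc).mono_set Ioo_subset_Icc_self
  refine Integrable.mul_bdd (c := √(1 + (L : ℝ) ^ 2)) hqI ?_ ?_
  · exact (((measurable_deriv f).pow_const 2).const_add 1).sqrt.aestronglyMeasurable
  · refine Filter.Eventually.of_forall fun x => ?_
    rw [Real.norm_of_nonneg (Real.sqrt_nonneg _), ← sq_abs (deriv f x), ← Real.norm_eq_abs]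
    have := norm_deriv_le_of_lipschitz (x₀ := x) hf
    gcongr

/-- Lemma 3.4 of the paper: the Poincaré–Friedrichs-type estimate
`‖v‖²_{L²(Ω_R)} ≤ (R−f₋)²‖∂₂v‖²_{L²(Ω_R)} + 2(R−f₋)‖v‖²_{L²(Γ)}`, where the boundary integral
over `Γ` carries the arclength weight `√(1 + f′(x₁)²)`. -/
theorem poincare_friedrichs_estimate
    (f : ℝ → ℝ) (hfper : ∀ t, f (t + 2 * π) = f t)
    (L : NNReal) (hflip : LipschitzWith L f)
    (fm : ℝ) (hfm : ∀ t, fm < f t)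
    (R : ℝ) (hR : GammaMax f < R)
    (v : ℝ × ℝ → ℂ) (hv : ContDiff ℝ 1 v) :
    (∫ x in OmegaR f R, ‖v x‖ ^ 2) ≤
      (R - fm) ^ 2 * (∫ x in OmegaR f R, ‖p2 v x‖ ^ 2) +
        2 * (R - fm) *
          ∫ x₁ in Ioo (0 : ℝ) (2 * π), ‖v (x₁, f x₁)‖ ^ 2 * Real.sqrt (1 + deriv f x₁ ^ 2) := by
  have hf := hflip.continuous
  have hvd : Continuous (p2 v) := (hv.continuous_fderiv one_ne_zero).clm_apply continuous_const
  have hvc := hv.continuous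
  have hc1 : Continuous fun x => ‖v x‖ ^ 2 := by fun_prop
  have hc2 : Continuous fun x => ‖p2 v x‖ ^ 2 := by fun_prop
  rw [setIntegral_omegaR hf hfm hc1, setIntegral_omegaR hf hfm hc2,
    ← integral_const_mul, ← integral_const_mul]
  have hI1 := integrableOn_integral_section hf hfm hc1 (R := R)
  have hI2 := (integrableOn_integral_section hf hfm hc2 (R := R)).const_mul ((R - fm) ^ 2)
  have hI3 := (integrableOn_mul_arclength hflip
    (q := fun x => ‖v (x, f x)‖ ^ 2) (by fun_prop) 0 (2 * π)).const_mul (2 * (R - fm))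
  rw [← integral_add hI2 hI3]
  refine setIntegral_mono_on hI1 (hI2.add hI3) measurableSet_Ioo fun x hx => ?_
  have hfR : f x < R := lt_of_gammaMax_lt hf hR (Ioo_subset_Icc_self hx)
  have hder : ∀ t, HasDerivAt (fun y => v (x, y)) (p2 v (x, t)) t := fun t =>
    ((hv.differentiable one_ne_zero) (x, t)).hasFDerivAt.comp_hasDerivAt t
      ((hasDerivAt_const t x).prodMk (hasDerivAt_id t))
  have hfib := setIntegral_Ioo_norm_sq_le hder (by fun_prop) hfR.le
  have hle : R - f x ≤ R - fm := by linarith [hfm x]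
  have hnn : 0 ≤ R - f x := by linarith
  have hw : 1 ≤ √(1 + deriv f x ^ 2) := Real.one_le_sqrt.2 (by nlinarith [sq_nonneg (deriv f x)])
  refine hfib.trans (add_le_add ?_ ?_)
  · exact mul_le_mul_of_nonneg_right (pow_le_pow_left₀ hnn hle 2)
      (integral_nonneg fun _ => sq_nonneg _)
  · exact mul_le_mul (by linarith) (le_mul_of_one_le_right (sq_nonneg _) hw)
      (sq_nonneg _) (by linarith)
end
end

section
/- Let u = u^i + u^s solve the Dirichlet grating problem (DBVP), and let ũ_n be the Fourier coefficients of the trace u(·,R), i.e. ũ_n = u_n e^{iβ_n R} for n ≠ 0 and ũ₀ = u₀ e^{iβR} + γ e^{−iβR}. Then ∫₀^{2π} ( |∂₂u(x₁,R)|² − |∂₁u(x₁,R)|² + k²|u(x₁,R)|² ) dx₁ ≤ 4πk · Σ_{n : |α_n| ≤ k} β_n |ũ_n|² − 8π β² · Re( u₀ · conj(γ) · e^{2iβR} ). (The sum 2π·Σ_{|α_n|≤k} β_n|ũ_n|² equals Im ∫_{Γ_R}(Tu)·conj(u) ds for the Dirichlet-to-Neumann map T on Γ_R.) -/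
open MeasureTheory Real Set

noncomputable section

/-- `u` solves the Dirichlet grating problem (DBVP) with incident wave `u^i = γ e^{i(αx₁ − βx₂)}`
and Rayleigh coefficients `uc`. -/
def SolvesDBVP (f : ℝ → ℝ) (k θ : ℝ) (γ : ℂ) (u : ℝ × ℝ → ℂ) (uc : ℤ → ℂ) : Prop :=
  QP (k * Real.sin θ) u ∧
  ContDiffOn ℝ 2 u {x : ℝ × ℝ | f x.1 < x.2} ∧
  (∀ x : ℝ × ℝ, f x.1 < x.2 → lap u x + (k : ℂ) ^ 2 * u x = 0) ∧
  (∀ x₁ ∈ Ioo (0 : ℝ) (2 * π), u (x₁, f x₁) = 0) ∧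
  (∀ x : ℝ × ℝ, GammaMax f < x.2 → u x - ui k θ γ x = ray k (k * Real.sin θ) uc x)

/-- The quasiperiodic Fourier mode `e^{i(n+α)x}`. -/
def quasiMode (α : ℝ) (n : ℤ) (x : ℝ) : ℂ :=
  Complex.exp (Complex.I * ((((n : ℝ) + α) * x : ℝ) : ℂ))

lemma norm_quasiMode (α : ℝ) (n : ℤ) (x : ℝ) : ‖quasiMode α n x‖ = 1 := by
  rw [quasiMode, mul_comm, Complex.norm_exp_ofReal_mul_I]

lemma continuous_quasiMode (α : ℝ) (n : ℤ) : Continuous (quasiMode α n) := by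
  unfold quasiMode
  fun_prop

lemma hasDerivAt_quasiMode (α : ℝ) (n : ℤ) (x : ℝ) :
    HasDerivAt (quasiMode α n)
      (Complex.I * (((n : ℝ) + α : ℝ) : ℂ) * quasiMode α n x) x := by
  have h1 : HasDerivAt (fun y : ℝ => ((((n : ℝ) + α) * y : ℝ) : ℂ)) (((n : ℝ) + α : ℝ) : ℂ) x := by
    have h0 : HasDerivAt (fun y : ℝ => ((n : ℝ) + α) * y) ((n : ℝ) + α) x := by
      simpa using (hasDerivAt_id x).const_mul ((n : ℝ) + α)
    exact h0.ofReal_comp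
  have h2 := (h1.const_mul Complex.I).cexp
  rw [mul_comm] at h2
  exact h2

lemma integral_quasiMode_mul_conj (α : ℝ) (n m : ℤ) :
    ∫ x in (0 : ℝ)..(2 * π), quasiMode α n x * (starRingEnd ℂ) (quasiMode α m x)
      = if n = m then ((2 * π : ℝ) : ℂ) else 0 := by
  have h (x : ℝ) : quasiMode α n x * (starRingEnd ℂ) (quasiMode α m x)
      = Complex.exp ((Complex.I * ((n - m : ℤ) : ℂ)) * (x : ℂ)) := by
    rw [quasiMode, quasiMode, ← Complex.exp_conj, ← Complex.exp_add]
    congr 1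
    simp only [map_mul, Complex.conj_I, Complex.conj_ofReal]
    push_cast
    ring
  simp_rw [h]
  split_ifs with hnm
  · subst hnm
    simp
  · have hc : Complex.I * ((n - m : ℤ) : ℂ) ≠ 0 :=
      mul_ne_zero Complex.I_ne_zero (by exact_mod_cast sub_ne_zero.mpr hnm)
    rw [integral_exp_mul_complex hc]
    have : Complex.I * ((n - m : ℤ) : ℂ) * ((2 * π : ℝ) : ℂ)
        = ((n - m : ℤ) : ℂ) * (2 * π * Complex.I) := by
      push_cast
      ring
    rw [this, Complex.exp_int_mul_two_pi_mul_I]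
    simp

lemma continuous_tsum_quasiMode (α : ℝ) {a : ℤ → ℂ} (ha : Summable a) :
    Continuous fun x => ∑' n, a n * quasiMode α n x :=
  continuous_tsum (fun n => continuous_const.mul (continuous_quasiMode α n)) ha.norm
    fun n x => by rw [norm_mul, norm_quasiMode, mul_one]

lemma summable_mul_quasiMode (α : ℝ) {a : ℤ → ℂ} (ha : Summable a) (x : ℝ) :
    Summable fun n => a n * quasiMode α n x :=
  Summable.of_norm (by simpa only [norm_mul, norm_quasiMode, mul_one] using ha.norm)

/-- Integration of an absolutely convergent quasiperiodic Fourier series against a bounded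
continuous function. -/
lemma hasSum_integral_quasiMode_mul (α : ℝ) {a : ℤ → ℂ} (ha : Summable a) {g : ℝ → ℂ}
    (hg : Continuous g) {C : ℝ} (hC : ∀ x, ‖g x‖ ≤ C) :
    HasSum (fun n => a n * ∫ x in (0 : ℝ)..(2 * π), quasiMode α n x * g x)
      (∫ x in (0 : ℝ)..(2 * π), (∑' n, a n * quasiMode α n x) * g x) := by
  have key := intervalIntegral.hasSum_integral_of_dominated_convergence
    (μ := volume) (a := 0) (b := 2 * π)
    (F := fun n x => a n * quasiMode α n x * g x)
    (f := fun x => (∑' n, a n * quasiMode α n x) * g x)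
    (fun n _ => ‖a n‖ * C)
    (fun n => (((continuous_const.mul (continuous_quasiMode α n)).mul hg)).aestronglyMeasurable)
    (fun n => .of_forall fun x _ => by
      rw [norm_mul, norm_mul, norm_quasiMode, mul_one]
      exact mul_le_mul_of_nonneg_left (hC x) (norm_nonneg _))
    (.of_forall fun x _ => ha.norm.mul_right C)
    (by simp)
    (.of_forall fun x _ => (summable_mul_quasiMode α ha x).hasSum.mul_right (g x))
  simpa only [mul_assoc, intervalIntegral.integral_const_mul] using key

/-- Parseval's identity for absolutely convergent quasiperiodic Fourier series. -/
lemma hasSum_parseval_quasiMode (α : ℝ) {a : ℤ → ℂ} (ha : Summable a) :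
    HasSum (fun n => 2 * π * ‖a n‖ ^ 2)
      (∫ x in Ioo (0 : ℝ) (2 * π), ‖∑' n, a n * quasiMode α n x‖ ^ 2) := by
  set S : ℝ → ℂ := fun x => ∑' n, a n * quasiMode α n x with hS
  have hSc : Continuous S := continuous_tsum_quasiMode α ha
  have hSb (x : ℝ) : ‖(starRingEnd ℂ) (S x)‖ ≤ ∑' n, ‖a n‖ := by
    rw [Complex.norm_conj]
    refine tsum_of_norm_bounded ha.norm.hasSum fun n => ?_
    rw [norm_mul, norm_quasiMode, mul_one]
  have hcoef (n : ℤ) : ∫ x in (0 : ℝ)..(2 * π), quasiMode α n x * (starRingEnd ℂ) (S x)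
      = (starRingEnd ℂ) (a n) * ((2 * π : ℝ) : ℂ) := by
    have h1 := hasSum_integral_quasiMode_mul α ha
      (Complex.continuous_conj.comp (continuous_quasiMode α n)) (C := 1)
      (fun x => by simp [norm_quasiMode])
    simp only [Function.comp_apply, integral_quasiMode_mul_conj] at h1
    have h2 := h1.unique (hasSum_single n fun m hm => by rw [if_neg hm, mul_zero])
    rw [if_pos rfl] at h2
    have h3 := congrArg (starRingEnd ℂ) h2
    rw [map_mul, Complex.conj_ofReal] at h3
    rw [← h3, intervalIntegral.integral_of_le (by positivity),
      intervalIntegral.integral_of_le (by positivity), ← integral_conj]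
    congr 1
    funext x
    simp [hS, mul_comm]
  have h := hasSum_integral_quasiMode_mul α ha (Complex.continuous_conj.comp hSc) hSb
  simp only [Function.comp_apply, hcoef] at h
  have hL : (∫ x in (0 : ℝ)..(2 * π), (∑' n, a n * quasiMode α n x) * (starRingEnd ℂ) (S x))
      = ((∫ x in Ioo (0 : ℝ) (2 * π), ‖S x‖ ^ 2 : ℝ) : ℂ) := by
    rw [← integral_Ioc_eq_integral_Ioo, ← intervalIntegral.integral_of_le (by positivity),
      ← intervalIntegral.integral_ofReal]
    refine intervalIntegral.integral_congr fun x _ => ?_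
    simp only [hS, Complex.mul_conj']
    push_cast
    rfl
  rw [hL] at h
  have hR : (fun n => a n * ((starRingEnd ℂ) (a n) * ((2 * π : ℝ) : ℂ)))
      = fun n => ((2 * π * ‖a n‖ ^ 2 : ℝ) : ℂ) := by
    funext n
    rw [← mul_assoc, Complex.mul_conj']
    push_cast
    ring
  rw [hR] at h
  exact_mod_cast h

lemma betan_im_nonneg (k α : ℝ) (n : ℤ) : 0 ≤ (betan k α n).im := by
  unfold betan
  split_ifs <;> simp

lemma norm_betan_le {k : ℝ} (hk : 0 ≤ k) (α : ℝ) (n : ℤ) :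
    ‖betan k α n‖ ≤ k + (betan k α n).im := by
  unfold betan
  split_ifs with h
  · rw [Complex.norm_real, Complex.ofReal_im, Real.norm_eq_abs, abs_of_nonneg (Real.sqrt_nonneg _),
      add_zero]
    exact Real.sqrt_le_iff.mpr ⟨hk, by nlinarith [sq_nonneg ((n : ℝ) + α)]⟩
  · simp [abs_of_nonneg (Real.sqrt_nonneg _), hk]

lemma abs_add_le_betan_im {k : ℝ} (hk : 0 ≤ k) (α : ℝ) (n : ℤ) :
    |(n : ℝ) + α| ≤ k + (betan k α n).im := by
  have him := betan_im_nonneg k α n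
  by_cases h : |(n : ℝ) + α| ≤ k
  · linarith
  · refine abs_le_of_sq_le_sq ?_ (by linarith)
    rw [betan, if_neg h]
    simp only [Complex.mul_im, Complex.I_re, Complex.I_im, Complex.ofReal_re, Complex.ofReal_im,
      mul_zero, zero_add, one_mul]
    have hlt : k ^ 2 < ((n : ℝ) + α) ^ 2 := by
      rw [← sq_abs ((n : ℝ) + α)]
      exact pow_lt_pow_left₀ (not_le.mp h) hk two_ne_zero
    nlinarith [Real.sq_sqrt (show 0 ≤ ((n : ℝ) + α) ^ 2 - k ^ 2 by linarith),
      Real.sqrt_nonneg (((n : ℝ) + α) ^ 2 - k ^ 2)]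

lemma add_mul_exp_neg_le {k m δ h t : ℝ} (hk : 0 ≤ k) (hm : 0 ≤ m) (hδ : 0 < δ)
    (ht : h + δ ≤ t) :
    (k + m) * Real.exp (-(m * t)) ≤ (k + 1 / δ) * Real.exp (-(m * h)) := by
  have h1 : Real.exp (-(m * t)) ≤ Real.exp (-(m * δ)) * Real.exp (-(m * h)) := by
    rw [← Real.exp_add]
    exact Real.exp_le_exp.mpr (by nlinarith)
  have h2 : (k + m) * Real.exp (-(m * δ)) ≤ k + 1 / δ := by
    have h3 : Real.exp (-(m * δ)) ≤ 1 := Real.exp_le_one_iff.mpr (by nlinarith [mul_nonneg hm hδ.le])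
    have h4 : m * Real.exp (-(m * δ)) ≤ 1 / δ := by
      rw [Real.exp_neg, ← div_eq_mul_inv, div_le_div_iff₀ (Real.exp_pos _) hδ]
      linarith [Real.add_one_le_exp (m * δ)]
    nlinarith
  calc (k + m) * Real.exp (-(m * t))
      ≤ (k + m) * (Real.exp (-(m * δ)) * Real.exp (-(m * h))) :=
        mul_le_mul_of_nonneg_left h1 (by linarith)
    _ = ((k + m) * Real.exp (-(m * δ))) * Real.exp (-(m * h)) := by ring
    _ ≤ _ := mul_le_mul_of_nonneg_right h2 (Real.exp_pos _).le

/-- The Fourier coefficients of the Rayleigh series at height `t`. -/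
def rayCoeff (k α : ℝ) (c : ℤ → ℂ) (t : ℝ) (n : ℤ) : ℂ :=
  c n * Complex.exp (Complex.I * betan k α n * (t : ℂ))

lemma ray_eq_tsum (k α : ℝ) (c : ℤ → ℂ) (x t : ℝ) :
    ray k α c (x, t) = ∑' n, rayCoeff k α c t n * quasiMode α n x := by
  unfold ray
  refine tsum_congr fun n => ?_
  rw [Complex.exp_add, rayCoeff, quasiMode]
  ring

lemma norm_rayCoeff (k α : ℝ) (c : ℤ → ℂ) (t : ℝ) (n : ℤ) :
    ‖rayCoeff k α c t n‖ = ‖c n‖ * Real.exp (-((betan k α n).im * t)) := by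
  rw [rayCoeff, norm_mul, Complex.norm_exp]
  simp

lemma mul_norm_rayCoeff_le {k α : ℝ} (hk : 0 ≤ k) (c : ℤ → ℂ) {h δ t : ℝ} (hδ : 0 < δ)
    (ht : h + δ ≤ t) (n : ℤ) :
    (k + (betan k α n).im) * ‖rayCoeff k α c t n‖ ≤ (k + 1 / δ) * ‖rayCoeff k α c h n‖ := by
  rw [norm_rayCoeff, norm_rayCoeff]
  have := mul_le_mul_of_nonneg_left
    (add_mul_exp_neg_le hk (betan_im_nonneg k α n) hδ ht) (norm_nonneg (c n))
  linarith

lemma summable_rayCoeff_of_le {k α : ℝ} {c : ℤ → ℂ} {h t : ℝ}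
    (hs : Summable (rayCoeff k α c h)) (ht : h ≤ t) : Summable (rayCoeff k α c t) := by
  refine Summable.of_norm_bounded hs.norm fun n => ?_
  rw [norm_rayCoeff, norm_rayCoeff]
  gcongr
  exact betan_im_nonneg k α n

lemma norm_I_mul_alpha_mul_rayCoeff_le {k α : ℝ} (hk : 0 ≤ k) (c : ℤ → ℂ) {h δ t : ℝ} (hδ : 0 < δ)
    (ht : h + δ ≤ t) (n : ℤ) :
    ‖Complex.I * (((n : ℝ) + α : ℝ) : ℂ) * rayCoeff k α c t n‖
      ≤ (k + 1 / δ) * ‖rayCoeff k α c h n‖ := by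
  refine le_trans ?_ (mul_norm_rayCoeff_le hk c hδ ht n)
  rw [norm_mul, norm_mul, Complex.norm_I, one_mul, Complex.norm_real, Real.norm_eq_abs]
  exact mul_le_mul_of_nonneg_right (abs_add_le_betan_im hk α n) (norm_nonneg _)

lemma norm_I_mul_betan_mul_rayCoeff_le {k α : ℝ} (hk : 0 ≤ k) (c : ℤ → ℂ) {h δ t : ℝ} (hδ : 0 < δ)
    (ht : h + δ ≤ t) (n : ℤ) :
    ‖Complex.I * betan k α n * rayCoeff k α c t n‖ ≤ (k + 1 / δ) * ‖rayCoeff k α c h n‖ := by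
  refine le_trans ?_ (mul_norm_rayCoeff_le hk c hδ ht n)
  rw [norm_mul, norm_mul, Complex.norm_I, one_mul]
  exact mul_le_mul_of_nonneg_right (norm_betan_le hk α n) (norm_nonneg _)

lemma hasDerivAt_ray_fst {k α : ℝ} (hk : 0 ≤ k) {c : ℤ → ℂ} {h t : ℝ}
    (hs : Summable (rayCoeff k α c h)) (ht : h < t) (x : ℝ) :
    HasDerivAt (fun y => ray k α c (y, t))
      (∑' n : ℤ, Complex.I * (((n : ℝ) + α : ℝ) : ℂ) * rayCoeff k α c t n * quasiMode α n x) x := by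
  simp_rw [ray_eq_tsum]
  refine hasDerivAt_tsum (u := fun n => (k + 1 / (t - h)) * ‖rayCoeff k α c h n‖) (y₀ := x)
    (g' := fun (n : ℤ) y => Complex.I * (((n : ℝ) + α : ℝ) : ℂ) * rayCoeff k α c t n * quasiMode α n y)
    (hs.norm.mul_left _) (fun n y => ?_) (fun n y => ?_)
    (summable_mul_quasiMode α (summable_rayCoeff_of_le hs ht.le) x) x
  · exact ((hasDerivAt_quasiMode α n y).const_mul _).congr_deriv (by ring)
  · rw [norm_mul, norm_quasiMode, mul_one]
    exact norm_I_mul_alpha_mul_rayCoeff_le hk c (sub_pos.mpr ht) (by linarith) n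

lemma hasDerivAt_ray_snd {k α : ℝ} (hk : 0 ≤ k) {c : ℤ → ℂ} {h t : ℝ}
    (hs : Summable (rayCoeff k α c h)) (ht : h < t) (x : ℝ) :
    HasDerivAt (fun s => ray k α c (x, s))
      (∑' n, Complex.I * betan k α n * rayCoeff k α c t n * quasiMode α n x) t := by
  simp_rw [ray_eq_tsum]
  refine hasDerivAt_tsum_of_isPreconnected (t := Ioi (h + (t - h) / 2))
    (u := fun n => (k + 1 / ((t - h) / 2)) * ‖rayCoeff k α c h n‖) (y₀ := t)
    (g' := fun n s => Complex.I * betan k α n * rayCoeff k α c s n * quasiMode α n x)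
    (hs.norm.mul_left _) isOpen_Ioi isPreconnected_Ioi (fun n s _ => ?_) (fun n s hs' => ?_)
    (by simp only [mem_Ioi]; linarith)
    (summable_mul_quasiMode α (summable_rayCoeff_of_le hs ht.le) x)
    (by simp only [mem_Ioi]; linarith)
  · have h1 : HasDerivAt (fun s : ℝ => Complex.I * betan k α n * (s : ℂ))
        (Complex.I * betan k α n) s := by
      simpa using (Complex.ofRealCLM.hasDerivAt (x := s)).const_mul (Complex.I * betan k α n)
    refine ((h1.cexp.const_mul (c n)).mul_const (quasiMode α n x)).congr_deriv ?_
    rw [rayCoeff]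
    ring
  · rw [norm_mul, norm_quasiMode, mul_one]
    exact norm_I_mul_betan_mul_rayCoeff_le hk c (by linarith) (mem_Ioi.mp hs').le n

lemma le_GammaMax {f : ℝ → ℝ} (hf : Continuous f) (hper : ∀ t, f (t + 2 * π) = f t) (t : ℝ) :
    f t ≤ GammaMax f := by
  obtain ⟨s, hs, hst⟩ := Function.Periodic.exists_mem_Ico₀ (f := f) hper (by positivity) t
  rw [hst]
  exact le_csSup (isCompact_Icc.image hf).bddAbove ⟨s, Ico_subset_Icc_self hs, rfl⟩

lemma isOpen_epigraph {f : ℝ → ℝ} (hf : Continuous f) : IsOpen {x : ℝ × ℝ | f x.1 < x.2} :=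
  isOpen_lt (hf.comp continuous_fst) continuous_snd

lemma hasDerivAt_ui_fst (k θ : ℝ) (γ : ℂ) (x t : ℝ) :
    HasDerivAt (fun y => ui k θ γ (y, t))
      (Complex.I * ((k * Real.sin θ : ℝ) : ℂ) * ui k θ γ (x, t)) x := by
  have h0 : HasDerivAt (fun y : ℝ => k * Real.sin θ * y - k * Real.cos θ * t)
      (k * Real.sin θ) x := by
    simpa using ((hasDerivAt_id x).const_mul (k * Real.sin θ)).sub_const (k * Real.cos θ * t)
  refine ((h0.ofReal_comp.const_mul Complex.I).cexp.const_mul γ).congr_deriv ?_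
  rw [ui]
  ring

lemma hasDerivAt_ui_snd (k θ : ℝ) (γ : ℂ) (x t : ℝ) :
    HasDerivAt (fun s => ui k θ γ (x, s))
      (-(Complex.I * ((k * Real.cos θ : ℝ) : ℂ) * ui k θ γ (x, t))) t := by
  have h0 : HasDerivAt (fun s : ℝ => k * Real.sin θ * x - k * Real.cos θ * s)
      (-(k * Real.cos θ)) t := by
    simpa using ((hasDerivAt_id t).const_mul (k * Real.cos θ)).const_sub (k * Real.sin θ * x)
  refine ((h0.ofReal_comp.const_mul Complex.I).cexp.const_mul γ).congr_deriv ?_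
  rw [ui]
  push_cast
  ring

lemma norm_ui (k θ : ℝ) (γ : ℂ) (x : ℝ × ℝ) : ‖ui k θ γ x‖ = ‖γ‖ := by
  rw [ui, norm_mul, mul_comm Complex.I, Complex.norm_exp_ofReal_mul_I, mul_one]

lemma ui_eq_quasiMode (k θ : ℝ) (γ : ℂ) (x t : ℝ) :
    ui k θ γ (x, t) = γ * Complex.exp (-Complex.I * ((k * Real.cos θ * t : ℝ) : ℂ)) *
      quasiMode (k * Real.sin θ) 0 x := by
  rw [ui, quasiMode, mul_assoc γ, ← Complex.exp_add]
  congr 2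
  push_cast
  ring

lemma hasDerivAt_p1 {u : ℝ × ℝ → ℂ} {x t : ℝ} (hu : DifferentiableAt ℝ u (x, t)) :
    HasDerivAt (fun y => u (y, t)) (p1 u (x, t)) x :=
  hu.hasFDerivAt.comp_hasDerivAt x ((hasDerivAt_id x).prodMk (hasDerivAt_const x t))

lemma hasDerivAt_p2 {u : ℝ × ℝ → ℂ} {x t : ℝ} (hu : DifferentiableAt ℝ u (x, t)) :
    HasDerivAt (fun s => u (x, s)) (p2 u (x, t)) t :=
  hu.hasFDerivAt.comp_hasDerivAt t ((hasDerivAt_const t x).prodMk (hasDerivAt_id t))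

lemma tsum_quasiMode_add_single (α : ℝ) {b : ℤ → ℂ} (hb : Summable b) (z : ℂ) (x : ℝ) :
    Summable (fun n => b n + if n = 0 then z else 0) ∧
    z * quasiMode α 0 x + ∑' n, b n * quasiMode α n x
      = ∑' n, (b n + if n = 0 then z else 0) * quasiMode α n x := by
  have hz : Summable fun n : ℤ => if n = 0 then z else 0 := (hasSum_ite_eq 0 z).summable
  refine ⟨hb.add hz, ?_⟩
  simp_rw [add_mul]
  rw [(summable_mul_quasiMode α hb x).tsum_add (summable_mul_quasiMode α hz x), add_comm]
  congr 1
  rw [tsum_eq_single 0 fun n hn => by rw [if_neg hn, zero_mul], if_pos rfl]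

lemma betan_zero {k θ : ℝ} (hk : 0 < k) (hcos : 0 < Real.cos θ) :
    |((0 : ℤ) : ℝ) + k * Real.sin θ| ≤ k ∧
      betan k (k * Real.sin θ) 0 = ((k * Real.cos θ : ℝ) : ℂ) := by
  have h : |((0 : ℤ) : ℝ) + k * Real.sin θ| ≤ k := by
    rw [Int.cast_zero, zero_add, abs_mul, abs_of_pos hk]
    exact mul_le_of_le_one_right hk.le (Real.abs_sin_le_one θ)
  refine ⟨h, ?_⟩
  rw [betan, if_pos h]
  congr 1
  rw [show k ^ 2 - (((0 : ℤ) : ℝ) + k * Real.sin θ) ^ 2 = (k * Real.cos θ) ^ 2 by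
    rw [mul_pow k (Real.cos θ), Real.cos_sq']
    push_cast
    ring]
  exact Real.sqrt_sq (mul_pos hk hcos).le

lemma betan_re_nonneg (k α : ℝ) (n : ℤ) : 0 ≤ (betan k α n).re := by
  unfold betan
  split_ifs <;> simp

/-- The contribution of a single upward mode to the Rellich boundary term. -/
lemma mode_rellich_le {k : ℝ} (hk : 0 ≤ k) (α : ℝ) (n : ℤ) (z : ℂ) :
    ‖Complex.I * betan k α n * z‖ ^ 2 - ‖Complex.I * (((n : ℝ) + α : ℝ) : ℂ) * z‖ ^ 2
        + k ^ 2 * ‖z‖ ^ 2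
      ≤ if |(n : ℝ) + α| ≤ k then 2 * k * ((betan k α n).re * ‖z‖ ^ 2) else 0 := by
  have hz := sq_nonneg ‖z‖
  simp only [norm_mul, Complex.norm_I, one_mul, mul_pow, Complex.norm_real, Real.norm_eq_abs,
    sq_abs]
  unfold betan
  split_ifs with h
  · have h1 : ((n : ℝ) + α) ^ 2 ≤ k ^ 2 := sq_le_sq' (abs_le.mp h).1 (abs_le.mp h).2
    have h2 := Real.sq_sqrt (sub_nonneg.mpr h1)
    have h3 := Real.sqrt_nonneg (k ^ 2 - ((n : ℝ) + α) ^ 2)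
    have h4 : √(k ^ 2 - ((n : ℝ) + α) ^ 2) ≤ k :=
      Real.sqrt_le_iff.mpr ⟨hk, by nlinarith [sq_nonneg ((n : ℝ) + α)]⟩
    rw [Complex.norm_real, Real.norm_eq_abs, sq_abs, Complex.ofReal_re]
    set s := √(k ^ 2 - ((n : ℝ) + α) ^ 2)
    have h5 : s ^ 2 ≤ k * s := by nlinarith
    nlinarith [mul_le_mul_of_nonneg_right h5 hz]
  · have h1 : k ^ 2 ≤ ((n : ℝ) + α) ^ 2 := by
      rw [← sq_abs ((n : ℝ) + α)]
      exact pow_le_pow_left₀ hk (not_le.mp h).le 2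
    rw [norm_mul, Complex.norm_I, one_mul, Complex.norm_real, Real.norm_eq_abs, sq_abs,
      Real.sq_sqrt (sub_nonneg.mpr h1)]
    exact le_of_eq (by ring)

lemma norm_sub_sq_eq_norm_add_sq_sub (A B : ℂ) :
    ‖A - B‖ ^ 2 = ‖A + B‖ ^ 2 - 4 * (A * (starRingEnd ℂ) B).re := by
  rw [← Complex.normSq_eq_norm_sq, ← Complex.normSq_eq_norm_sq, Complex.normSq_sub,
    Complex.normSq_add]
  ring

lemma summable_ite_abs_le {k α : ℝ} (v : ℤ → ℝ) :
    Summable fun n : ℤ => if |(n : ℝ) + α| ≤ k then v n else 0 := by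
  refine summable_of_hasFiniteSupport ?_
  refine (Set.finite_Icc ⌊-k - α⌋ ⌈k - α⌉).subset fun n hn => ?_
  have h : |(n : ℝ) + α| ≤ k := by
    by_contra h
    exact hn (if_neg h)
  rw [abs_le] at h
  constructor
  · exact_mod_cast (Int.floor_le (-k - α)).trans (by linarith : -k - α ≤ (n : ℝ))
  · exact_mod_cast (by linarith : (n : ℝ) ≤ k - α).trans (Int.le_ceil (k - α))

lemma incident_mul_conj (c γ : ℂ) (s : ℝ) :
    c * Complex.exp (Complex.I * (s : ℂ)) *
        (starRingEnd ℂ) (γ * Complex.exp (-Complex.I * (s : ℂ)))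
      = c * (starRingEnd ℂ) γ * Complex.exp (2 * Complex.I * (s : ℂ)) := by
  rw [map_mul, ← Complex.exp_conj, map_mul, map_neg, Complex.conj_I, Complex.conj_ofReal, neg_neg,
    show 2 * Complex.I * (s : ℂ) = Complex.I * s + Complex.I * s by ring, Complex.exp_add]
  ring

/-- The estimate when the Rayleigh series converges slightly below `Γ_R`. -/
lemma rellich_estimate_of_summable {k θ R h : ℝ} {γ : ℂ} (hk : 0 < k) (hcos : 0 < Real.cos θ)
    {u : ℝ × ℝ → ℂ} {uc ut : ℤ → ℂ} (hs : Summable (rayCoeff k (k * Real.sin θ) uc h))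
    (hhR : h < R)
    (hrepr : ∀ x : ℝ × ℝ, h < x.2 → u x = ui k θ γ x + ray k (k * Real.sin θ) uc x)
    (hdiff : ∀ x, DifferentiableAt ℝ u (x, R))
    (hut : ∀ n : ℤ, ut n =
      if n = 0 then
        uc 0 * Complex.exp (Complex.I * ((k * Real.cos θ * R : ℝ) : ℂ)) +
          γ * Complex.exp (-(Complex.I) * ((k * Real.cos θ * R : ℝ) : ℂ))
      else uc n * Complex.exp (Complex.I * betan k (k * Real.sin θ) n * (R : ℂ))) :
    (∫ x₁ in Ioo (0 : ℝ) (2 * π),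
        (‖p2 u (x₁, R)‖ ^ 2 - ‖p1 u (x₁, R)‖ ^ 2 + k ^ 2 * ‖u (x₁, R)‖ ^ 2)) ≤
      4 * π * k *
          (∑' n : ℤ, if |(n : ℝ) + k * Real.sin θ| ≤ k then
              (betan k (k * Real.sin θ) n).re * ‖ut n‖ ^ 2 else 0) -
        8 * π * (k * Real.cos θ) ^ 2 *
          (uc 0 * (starRingEnd ℂ) γ *
            Complex.exp (2 * Complex.I * ((k * Real.cos θ * R : ℝ) : ℂ))).re := by
  set α := k * Real.sin θ with hα
  set β := k * Real.cos θ with hβ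
  obtain ⟨hprop0, hbeta0⟩ := betan_zero hk hcos
  rw [← hα] at hprop0 hbeta0
  rw [← hβ] at hbeta0
  set d := rayCoeff k α uc R with hd
  set z := γ * Complex.exp (-Complex.I * ((β * R : ℝ) : ℂ)) with hz
  have hd0 : d 0 = uc 0 * Complex.exp (Complex.I * ((β * R : ℝ) : ℂ)) := by
    rw [hd, rayCoeff, hbeta0]
    push_cast
    rw [mul_assoc]
  have hut' (n : ℤ) : ut n = d n + if n = 0 then z else 0 := by
    rw [hut]
    split_ifs with hn
    · rw [hn, hd0]
    · rw [add_zero, hd, rayCoeff]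
  have hsδ := hs.norm.mul_left (k + 1 / (R - h))
  have hδ : 0 < R - h := sub_pos.mpr hhR
  have hsd : Summable d := summable_rayCoeff_of_le hs hhR.le
  obtain ⟨hs0, -⟩ := tsum_quasiMode_add_single α hsd z 0
  have hs1 : Summable fun n : ℤ => Complex.I * (((n : ℝ) + α : ℝ) : ℂ) * d n :=
    Summable.of_norm_bounded hsδ
      fun n => norm_I_mul_alpha_mul_rayCoeff_le hk.le uc hδ (by linarith) n
  have hs2 : Summable fun n : ℤ => Complex.I * betan k α n * d n :=
    Summable.of_norm_bounded hsδ
      fun n => norm_I_mul_betan_mul_rayCoeff_le hk.le uc hδ (by linarith) n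
  obtain ⟨hs1', -⟩ := tsum_quasiMode_add_single α hs1 (Complex.I * (α : ℂ) * z) 0
  obtain ⟨hs2', -⟩ := tsum_quasiMode_add_single α hs2 (-(Complex.I * (β : ℂ) * z)) 0
  have hu0 (x : ℝ) : u (x, R) = ∑' n, (d n + if n = 0 then z else 0) * quasiMode α n x := by
    rw [hrepr _ hhR, ray_eq_tsum, ui_eq_quasiMode,
      ← (tsum_quasiMode_add_single α hsd z x).2]
  have hu1 (x : ℝ) : p1 u (x, R) = ∑' n : ℤ, (Complex.I * (((n : ℝ) + α : ℝ) : ℂ) * d n +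
      if n = 0 then Complex.I * (α : ℂ) * z else 0) * quasiMode α n x := by
    rw [← (tsum_quasiMode_add_single α hs1 (Complex.I * (α : ℂ) * z) x).2]
    have hsum := (hasDerivAt_ui_fst k θ γ x R).add (hasDerivAt_ray_fst hk.le hs hhR x)
    refine (hasDerivAt_p1 (hdiff x)).unique
      ((hsum.congr_of_eventuallyEq (.of_forall fun y => ?_)).congr_deriv ?_)
    · exact hrepr (y, R) hhR
    · rw [ui_eq_quasiMode, mul_assoc (Complex.I * (α : ℂ))]
  have hu2 (x : ℝ) : p2 u (x, R) = ∑' n : ℤ, (Complex.I * betan k α n * d n +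
      if n = 0 then -(Complex.I * (β : ℂ) * z) else 0) * quasiMode α n x := by
    rw [← (tsum_quasiMode_add_single α hs2 (-(Complex.I * (β : ℂ) * z)) x).2]
    have hsum := (hasDerivAt_ui_snd k θ γ x R).add (hasDerivAt_ray_snd hk.le hs hhR x)
    refine (hasDerivAt_p2 (hdiff x)).unique
      ((hsum.congr_of_eventuallyEq ?_).congr_deriv ?_)
    · filter_upwards [lt_mem_nhds hhR] with t ht
      exact hrepr (x, t) ht
    · rw [ui_eq_quasiMode, neg_mul (Complex.I * (β : ℂ) * z), mul_assoc (Complex.I * (β : ℂ))]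
  have hint {a : ℤ → ℂ} (ha : Summable a) :
      Integrable (fun x => ‖∑' n, a n * quasiMode α n x‖ ^ 2)
        (volume.restrict (Ioo (0 : ℝ) (2 * π))) :=
    (((continuous_tsum_quasiMode α ha).norm.pow 2).integrableOn_Icc).mono_set Ioo_subset_Icc_self
  simp_rw [hu0, hu1, hu2]
  have hadd := integral_add ((hint hs2').sub (hint hs1')) ((hint hs0).const_mul (k ^ 2))
  simp only [Pi.sub_apply] at hadd
  rw [hadd, integral_sub (hint hs2') (hint hs1'), integral_const_mul]
  set w := (uc 0 * (starRingEnd ℂ) γ * Complex.exp (2 * Complex.I * ((β * R : ℝ) : ℂ))).re with hw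
  have hL := ((hasSum_parseval_quasiMode α hs2').sub (hasSum_parseval_quasiMode α hs1')).add
    ((hasSum_parseval_quasiMode α hs0).mul_left (k ^ 2))
  have hR1 := (summable_ite_abs_le (k := k) (α := α)
    (fun n => (betan k α n).re * ‖ut n‖ ^ 2)).hasSum.mul_left (4 * π * k)
  have hR := hR1.sub (hasSum_ite_eq (0 : ℤ) (8 * π * β ^ 2 * w))
  refine hasSum_le (fun n => ?_) hL hR
  rcases eq_or_ne n 0 with rfl | hn
  · have hm := mode_rellich_le hk.le α 0 (ut 0)
    simp only [if_true, if_pos hprop0] at hm ⊢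
    have hA : ut 0 = d 0 + z := by rw [hut', if_pos rfl]
    have hN : ‖Complex.I * betan k α 0 * d 0 + -(Complex.I * (β : ℂ) * z)‖ ^ 2
        = ‖Complex.I * betan k α 0 * ut 0‖ ^ 2 - 4 * β ^ 2 * w := by
      rw [hbeta0, show Complex.I * (β : ℂ) * d 0 + -(Complex.I * (β : ℂ) * z)
        = Complex.I * (β : ℂ) * (d 0 - z) by ring, norm_mul, mul_pow,
        norm_sub_sq_eq_norm_add_sq_sub, hA, norm_mul _ (d 0 + z), mul_pow _ ‖d 0 + z‖, hw, hd0, hz,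
        incident_mul_conj, norm_mul, Complex.norm_I, one_mul, Complex.norm_real, Real.norm_eq_abs,
        sq_abs]
      ring
    have hN1 : Complex.I * ((((0 : ℤ) : ℝ) + α : ℝ) : ℂ) * d 0 + Complex.I * (α : ℂ) * z
        = Complex.I * ((((0 : ℤ) : ℝ) + α : ℝ) : ℂ) * ut 0 := by
      rw [hA, Int.cast_zero, zero_add]
      ring
    rw [hN, hN1, ← hA]
    nlinarith [mul_le_mul_of_nonneg_left hm (by positivity : 0 ≤ 2 * π)]
  · have hm := mode_rellich_le hk.le α n (d n)
    have hA : ut n = d n := by rw [hut', if_neg hn, add_zero]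
    simp only [if_neg hn, add_zero, sub_zero, hA]
    have hm' := mul_le_mul_of_nonneg_left hm (by positivity : 0 ≤ 2 * π)
    split_ifs at hm' ⊢ <;> linarith

/-- The estimate when the field coincides with the incident wave just below `Γ_R`. -/
lemma rellich_estimate_of_eq_ui {k θ R h : ℝ} {γ : ℂ} (hk : 0 < k) (hcos : 0 < Real.cos θ)
    (hR : h < R) {Ω : Set (ℝ × ℝ)} (hΩ : IsOpen Ω)
    {u : ℝ × ℝ → ℂ} {uc ut : ℤ → ℂ} (hreg : ContDiffOn ℝ 2 u Ω)
    (hmem : ∀ x t : ℝ, h < t → (x, t) ∈ Ω)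
    (hstrip : ∀ x t : ℝ, t ∈ Ioo h R → u (x, t) = ui k θ γ (x, t))
    (hut : ut 0 = if (0 : ℤ) = 0 then
        uc 0 * Complex.exp (Complex.I * ((k * Real.cos θ * R : ℝ) : ℂ)) +
          γ * Complex.exp (-(Complex.I) * ((k * Real.cos θ * R : ℝ) : ℂ))
      else uc 0 * Complex.exp (Complex.I * betan k (k * Real.sin θ) 0 * (R : ℂ))) :
    (∫ x₁ in Ioo (0 : ℝ) (2 * π),
        (‖p2 u (x₁, R)‖ ^ 2 - ‖p1 u (x₁, R)‖ ^ 2 + k ^ 2 * ‖u (x₁, R)‖ ^ 2)) ≤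
      4 * π * k *
          (∑' n : ℤ, if |(n : ℝ) + k * Real.sin θ| ≤ k then
              (betan k (k * Real.sin θ) n).re * ‖ut n‖ ^ 2 else 0) -
        8 * π * (k * Real.cos θ) ^ 2 *
          (uc 0 * (starRingEnd ℂ) γ *
            Complex.exp (2 * Complex.I * ((k * Real.cos θ * R : ℝ) : ℂ))).re := by
  have hdiff (x t : ℝ) (ht : h < t) : DifferentiableAt ℝ u (x, t) :=
    (hreg.differentiableOn two_ne_zero).differentiableAt (hΩ.mem_nhds (hmem x t ht))
  have hfd (x : ℝ) : ContinuousAt (fun t => fderiv ℝ u (x, t)) R :=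
    ((hreg.continuousOn_fderiv_of_isOpen hΩ one_le_two).continuousAt
      (hΩ.mem_nhds (hmem x R hR))).comp (f := fun t : ℝ => (x, t)) (by fun_prop)
  have hmid : ∀ᶠ t in nhdsWithin R (Iio R), t ∈ Ioo h R := Ioo_mem_nhdsLT hR
  have hlim {F G : ℝ → ℂ} (hF : ContinuousAt F R) (hG : ContinuousAt G R)
      (hFG : ∀ t ∈ Ioo h R, F t = G t) : F R = G R :=
    tendsto_nhds_unique (hF.tendsto.mono_left nhdsWithin_le_nhds)
      ((hG.tendsto.mono_left nhdsWithin_le_nhds).congr'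
        (hmid.mono fun t ht => (hFG t ht).symm))
  have hui (x : ℝ) : Continuous fun t : ℝ => ui k θ γ (x, t) := by
    unfold ui
    fun_prop
  have hu0 (x : ℝ) : u (x, R) = ui k θ γ (x, R) :=
    hlim ((hdiff x R hR).continuousAt.comp (f := fun t : ℝ => (x, t)) (by fun_prop))
      (hui x).continuousAt (fun t ht => hstrip x t ht)
  have hu1 (x : ℝ) : p1 u (x, R) = Complex.I * ((k * Real.sin θ : ℝ) : ℂ) * ui k θ γ (x, R) :=
    hlim (F := fun t => p1 u (x, t))
      (G := fun t => Complex.I * ((k * Real.sin θ : ℝ) : ℂ) * ui k θ γ (x, t))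
      ((hfd x).clm_apply continuousAt_const) (continuous_const.mul (hui x)).continuousAt
      fun t ht => (hasDerivAt_p1 (hdiff x t ht.1)).unique
        ((hasDerivAt_ui_fst k θ γ x t).congr_of_eventuallyEq
          (.of_forall fun y => hstrip y t ht))
  have hu2 (x : ℝ) : p2 u (x, R) = -(Complex.I * ((k * Real.cos θ : ℝ) : ℂ) * ui k θ γ (x, R)) :=
    hlim (F := fun t => p2 u (x, t))
      (G := fun t => -(Complex.I * ((k * Real.cos θ : ℝ) : ℂ) * ui k θ γ (x, t)))
      ((hfd x).clm_apply continuousAt_const) (continuous_const.mul (hui x)).neg.continuousAt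
      fun t ht => (hasDerivAt_p2 (hdiff x t ht.1)).unique
        ((hasDerivAt_ui_snd k θ γ x t).congr_of_eventuallyEq
          (Filter.eventually_of_mem (Ioo_mem_nhds ht.1 ht.2) fun s hs => hstrip x s hs))
  obtain ⟨hprop0, hbeta0⟩ := betan_zero hk hcos
  have hsum : k * Real.cos θ * ‖ut 0‖ ^ 2 ≤
      ∑' n : ℤ, if |(n : ℝ) + k * Real.sin θ| ≤ k then
        (betan k (k * Real.sin θ) n).re * ‖ut n‖ ^ 2 else 0 := by
    have := (summable_ite_abs_le (k := k) (α := k * Real.sin θ)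
      (fun n => (betan k (k * Real.sin θ) n).re * ‖ut n‖ ^ 2)).le_tsum 0 fun n _ => by
        split_ifs
        · exact mul_nonneg (betan_re_nonneg _ _ _) (sq_nonneg _)
        · exact le_rfl
    rwa [if_pos hprop0, hbeta0, Complex.ofReal_re] at this
  simp_rw [hu0, hu1, hu2]
  simp only [norm_neg, norm_mul, Complex.norm_I, one_mul, mul_pow, Complex.norm_real,
    Real.norm_eq_abs, sq_abs, norm_ui, setIntegral_const, smul_eq_mul]
  rw [Measure.real, Real.volume_Ioo, ENNReal.toReal_ofReal (by linarith [Real.pi_pos])]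
  set A := uc 0 * Complex.exp (Complex.I * ((k * Real.cos θ * R : ℝ) : ℂ)) with hA
  set B := γ * Complex.exp (-Complex.I * ((k * Real.cos θ * R : ℝ) : ℂ)) with hB
  rw [if_pos rfl] at hut
  rw [← incident_mul_conj, ← hA, ← hB]
  have hBn : ‖B‖ = ‖γ‖ := by
    rw [hB, norm_mul, Complex.norm_exp]
    simp
  have hAB : |(A * (starRingEnd ℂ) B).re| ≤ ‖A‖ * ‖γ‖ := by
    simpa [hBn] using Complex.abs_re_le_norm (A * (starRingEnd ℂ) B)
  have hsq : ‖ut 0‖ ^ 2 = ‖A‖ ^ 2 + ‖γ‖ ^ 2 + 2 * (A * (starRingEnd ℂ) B).re := by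
    rw [hut, ← hBn, ← Complex.normSq_eq_norm_sq, ← Complex.normSq_eq_norm_sq,
      ← Complex.normSq_eq_norm_sq, Complex.normSq_add]
  rw [hsq] at hsum
  have hw := (abs_le.mp hAB).1
  set w := (A * (starRingEnd ℂ) B).re
  set a := ‖A‖
  set g := ‖γ‖
  have hc1 : Real.cos θ ≤ 1 := Real.cos_le_one θ
  have hsin : Real.sin θ ^ 2 = 1 - Real.cos θ ^ 2 := Real.sin_sq θ
  set c := Real.cos θ
  have key : c * g ^ 2 ≤ a ^ 2 + g ^ 2 + 2 * (1 - c) * w := by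
    nlinarith [mul_le_mul_of_nonneg_left hw (by linarith : 0 ≤ 2 * (1 - c)),
      mul_nonneg (sub_nonneg.mpr hc1) (sq_nonneg (a - g)), mul_nonneg hcos.le (sq_nonneg a)]
  have hpi := Real.pi_pos
  have h1 := mul_le_mul_of_nonneg_left hsum (by positivity : 0 ≤ 4 * π * k)
  have h2 := mul_le_mul_of_nonneg_left key (by positivity : 0 ≤ 4 * π * k ^ 2 * c)
  rw [hsin]
  nlinarith

/-- Lemma 3.5 of the paper: the boundary term on `Γ_R` of the Rellich identity
is controlled by `2k·Im∫_{Γ_R}(Tu)ū ds − 8πβ²Re(u₀ γ̄ e^{2iβR})`, with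
`ũ_n = u_n e^{iβ_n R}` for `n ≠ 0` and `ũ₀ = u₀e^{iβR} + γe^{−iβR}`. -/
theorem dirichlet_boundary_rellich_estimate
    (f : ℝ → ℝ) (hfper : ∀ t, f (t + 2 * π) = f t)
    (L : NNReal) (hflip : LipschitzWith L f)
    (fm : ℝ) (hfm : ∀ t, fm < f t)
    (k θ : ℝ) (hk : 0 < k) (hθ : θ ∈ Ioo (-(π / 2)) (π / 2)) (γ : ℂ)
    (R : ℝ) (hR : GammaMax f < R)
    (u : ℝ × ℝ → ℂ) (uc : ℤ → ℂ)
    (hu : SolvesDBVP f k θ γ u uc)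
    (ut : ℤ → ℂ)
    (hut : ∀ n : ℤ, ut n =
      if n = 0 then
        uc 0 * Complex.exp (Complex.I * ((k * Real.cos θ * R : ℝ) : ℂ)) +
          γ * Complex.exp (-(Complex.I) * ((k * Real.cos θ * R : ℝ) : ℂ))
      else uc n * Complex.exp (Complex.I * betan k (k * Real.sin θ) n * (R : ℂ))) :
    (∫ x₁ in Ioo (0 : ℝ) (2 * π),
        (‖p2 u (x₁, R)‖ ^ 2 - ‖p1 u (x₁, R)‖ ^ 2 + k ^ 2 * ‖u (x₁, R)‖ ^ 2)) ≤
      4 * π * k *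
          (∑' n : ℤ, if |(n : ℝ) + k * Real.sin θ| ≤ k then
              (betan k (k * Real.sin θ) n).re * ‖ut n‖ ^ 2 else 0) -
        8 * π * (k * Real.cos θ) ^ 2 *
          (uc 0 * (starRingEnd ℂ) γ *
            Complex.exp (2 * Complex.I * ((k * Real.cos θ * R : ℝ) : ℂ))).re := by
  obtain ⟨-, hreg, -, -, hray⟩ := hu
  have hΓ (x : ℝ) : f x ≤ GammaMax f := le_GammaMax hflip.continuous hfper x
  have hopen := isOpen_epigraph hflip.continuous
  have hmem (x : ℝ) {t : ℝ} (ht : GammaMax f < t) : (x, t) ∈ {x : ℝ × ℝ | f x.1 < x.2} :=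
    (hΓ x).trans_lt ht
  have hcos : 0 < Real.cos θ := Real.cos_pos_of_mem_Ioo hθ
  have hrepr (x : ℝ × ℝ) (hx : GammaMax f < x.2) :
      u x = ui k θ γ x + ray k (k * Real.sin θ) uc x := by
    rw [← hray x hx]
    ring
  have hdiff (x t : ℝ) (ht : GammaMax f < t) : DifferentiableAt ℝ u (x, t) :=
    (hreg.differentiableOn two_ne_zero).differentiableAt (hopen.mem_nhds (hmem x ht))
  by_cases hsum : ∃ h, GammaMax f < h ∧ h < R ∧ Summable (rayCoeff k (k * Real.sin θ) uc h)
  · obtain ⟨h, hh, hhR, hs⟩ := hsum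
    exact rellich_estimate_of_summable hk hcos hs hhR
      (fun x hx => hrepr x (hh.trans hx)) (fun x => hdiff x R hR) hut
  · push Not at hsum
    have hstrip (x t : ℝ) (ht : t ∈ Ioo (GammaMax f) R) : u (x, t) = ui k θ γ (x, t) := by
      rw [hrepr _ ht.1, ray_eq_tsum, tsum_eq_zero_of_not_summable, add_zero]
      intro hs
      refine hsum t ht.1 ht.2 (Summable.of_norm ?_)
      simpa only [norm_mul, norm_quasiMode, mul_one] using hs.norm
    exact rellich_estimate_of_eq_ui hk hcos hR hopen hreg (fun x t ht => hmem x ht) hstrip (hut 0)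
end
end

section
/- Let v be α-quasiperiodic and C² on the closure of Ω_R, and let c ∈ ℝ be a constant. Then the Rellich identity holds: 2·Re ∫_{Ω_R} (x₂−c)·∂₂v̄·(Δv + k²v) dx − ∫_{Ω_R} ( |∇v|² − k²|v|² − 2|∂₂v|² ) dx = (∫_{Γ_R} − ∫_Γ)(x₂−c)·[ −ν₂|∇v|² + ν₂k²|v|² + 2Re(∂₂v̄·∂_ν v) ] ds, where ν = (ν₁,ν₂) is the unit normal on Γ ∪ Γ_R pointing upward (ν = (0,1) on Γ_R and ν = (−f′(x₁),1)/√(1+f′(x₁)²) on Γ). -/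
open MeasureTheory Real Set

noncomputable section

theorem measurableSet_OmegaR {f : ℝ → ℝ} (hf : Continuous f) (R : ℝ) :
    MeasurableSet (OmegaR f R) := by
  have : IsOpen (OmegaR f R) := by
    have e : OmegaR f R = {x | 0 < x.1} ∩ ({x | x.1 < 2 * π} ∩ ({x | f x.1 < x.2} ∩
      {x | x.2 < R})) := rfl
    rw [e]
    exact (isOpen_lt (by fun_prop) (by fun_prop)).inter ((isOpen_lt (by fun_prop)
      (by fun_prop)).inter ((isOpen_lt (by fun_prop) (by fun_prop)).inter
        (isOpen_lt (by fun_prop) (by fun_prop))))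
  exact this.measurableSet

theorem integrableOn_OmegaR {E : Type*} [NormedAddCommGroup E]
    {f : ℝ → ℝ} (hf : Continuous f) (R : ℝ) {φ : ℝ × ℝ → E} (hφ : Continuous φ) :
    IntegrableOn φ (OmegaR f R) := by
  obtain ⟨m, hm⟩ := (isCompact_Icc (a := (0 : ℝ)) (b := 2 * π)).bddBelow_image hf.continuousOn
  have hK : IsCompact (Icc (0 : ℝ) (2 * π) ×ˢ Icc m R) := isCompact_Icc.prod isCompact_Icc
  refine (hφ.continuousOn.integrableOn_compact hK).mono_set ?_
  rintro x ⟨h0, h1, h2, h3⟩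
  exact ⟨⟨h0.le, h1.le⟩, (hm (mem_image_of_mem f ⟨h0.le, h1.le⟩)).trans h2.le, h3.le⟩

/-- Fubini's theorem on the periodic cell. -/
theorem integral_OmegaR {f : ℝ → ℝ} (hf : Continuous f) {R : ℝ}
    (hR : ∀ x ∈ Icc 0 (2 * π), f x < R) {φ : ℝ × ℝ → ℝ} (hφ : Continuous φ) :
    ∫ x in OmegaR f R, φ x = ∫ x in (0 : ℝ)..2 * π, ∫ y in f x..R, φ (x, y) := by
  have hm := measurableSet_OmegaR hf R
  rw [← integral_indicator hm, Measure.volume_eq_prod, integral_prod _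
    ((integrable_indicator_iff hm).2 (integrableOn_OmegaR hf R hφ)),
    intervalIntegral.integral_of_le (by positivity), integral_Ioc_eq_integral_Ioo,
    ← integral_indicator measurableSet_Ioo]
  congr 1 with x
  by_cases hx : x ∈ Ioo 0 (2 * π)
  · rw [indicator_of_mem hx, intervalIntegral.integral_of_le (hR x (Ioo_subset_Icc_self hx)).le,
      integral_Ioc_eq_integral_Ioo, ← integral_indicator measurableSet_Ioo]
    congr 1 with y
    simp only [indicator, OmegaR, mem_ofPred_eq, mem_Ioo]
    have h1 := hx.1
    have h2 := hx.2
    simp [h1, h2]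
  · rw [indicator_of_notMem hx]
    have (y : ℝ) : (OmegaR f R).indicator φ (x, y) = 0 :=
      indicator_of_notMem (fun h => hx ⟨h.1, h.2.1⟩) _
    simp [this]

theorem intervalIntegral_swap_of_continuous {F : ℝ × ℝ → ℝ} (hF : Continuous F) {a b c d : ℝ}
    (hab : a ≤ b) (hcd : c ≤ d) :
    ∫ x in a..b, ∫ y in c..d, F (x, y) = ∫ y in c..d, ∫ x in a..b, F (x, y) := by
  simp only [intervalIntegral.integral_of_le hab, intervalIntegral.integral_of_le hcd]
  refine integral_integral_swap (f := fun x y => F (x, y)) ?_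
  rw [Measure.prod_restrict]
  exact (hF.continuousOn.integrableOn_compact (isCompact_Icc.prod isCompact_Icc)).mono_set
    (prod_mono Ioc_subset_Icc_self Ioc_subset_Icc_self)

theorem integral_fderiv_snd {Q : ℝ × ℝ → ℝ} (hQ : ContDiff ℝ 1 Q) (x a b : ℝ) :
    ∫ y in a..b, fderiv ℝ Q (x, y) (0, 1) = Q (x, b) - Q (x, a) := by
  have hc : Continuous (fderiv ℝ Q) := hQ.continuous_fderiv one_ne_zero
  refine intervalIntegral.integral_eq_sub_of_hasDerivAt (f := fun y => Q (x, y)) (fun y _ => ?_)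
    (Continuous.intervalIntegrable (by fun_prop) _ _)
  exact ((hQ.differentiable one_ne_zero (x, y)).hasFDerivAt).comp_hasDerivAt y
    ((hasDerivAt_const y x).prodMk (hasDerivAt_id y))

/-- For a function periodic in the first variable, the integral of its first partial derivative
over the cell reduces to the flux through the lower boundary. -/
theorem integral_fderiv_fst {f : ℝ → ℝ} (hf : ContDiff ℝ 1 f) {T : ℝ} (hT : 0 ≤ T)
    (hfT : f T = f 0) (R : ℝ) {P : ℝ × ℝ → ℝ} (hP : ContDiff ℝ 1 P)
    (hPT : ∀ y, P (T, y) = P (0, y)) :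
    ∫ x in (0 : ℝ)..T, ∫ y in f x..R, fderiv ℝ P (x, y) (1, 0) =
      ∫ x in (0 : ℝ)..T, deriv f x * P (x, f x) := by
  have hfd : Differentiable ℝ f := hf.differentiable one_ne_zero
  have hPd : Differentiable ℝ P := hP.differentiable one_ne_zero
  have hfc : Continuous f := hf.continuous
  have hPc : Continuous P := hP.continuous
  have hf' : Continuous (deriv f) := hf.continuous_deriv le_rfl
  have hP' : Continuous (fderiv ℝ P) := hP.continuous_fderiv one_ne_zero
  have split (x y : ℝ) (a b : ℝ) : fderiv ℝ P (x, y) (a, b) =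
      a * fderiv ℝ P (x, y) (1, 0) + b * fderiv ℝ P (x, y) (0, 1) := by
    have : ((a, b) : ℝ × ℝ) = a • (1, 0) + b • (0, 1) := by simp
    rw [this, map_add, map_smul, map_smul, smul_eq_mul, smul_eq_mul]
  let H : ℝ × ℝ → ℝ := fun p =>
    -deriv f p.1 * P (p.1, f p.1 + (R - f p.1) * p.2) + (R - f p.1) *
      (fderiv ℝ P (p.1, f p.1 + (R - f p.1) * p.2) (1, 0) +
        (deriv f p.1 * (1 - p.2)) * fderiv ℝ P (p.1, f p.1 + (R - f p.1) * p.2) (0, 1))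
  have hH : Continuous H := by fun_prop
  have hHx (t x : ℝ) :
      HasDerivAt (fun x => (R - f x) * P (x, f x + (R - f x) * t)) (H (x, t)) x := by
    have h1 := (hfd x).hasDerivAt
    have h2 : HasDerivAt (fun x => (x, f x + (R - f x) * t)) (1, deriv f x + (-deriv f x) * t) x :=
      (hasDerivAt_id x).prodMk (h1.add ((h1.const_sub R).mul_const t))
    have h3 := (h1.const_sub R).mul
      ((hPd (x, f x + (R - f x) * t)).hasFDerivAt.comp_hasDerivAt x h2)
    refine h3.congr_deriv ?_
    simp only [H, Function.comp_apply]
    rw [split _ _ 1]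
    ring
  let K : ℝ → ℝ → ℝ := fun x t => -P (x, f x + (R - f x) * t) +
    (1 - t) * ((R - f x) * fderiv ℝ P (x, f x + (R - f x) * t) (0, 1))
  have hKt (x t : ℝ) : HasDerivAt (fun t => (1 - t) * P (x, f x + (R - f x) * t)) (K x t) t := by
    have h2 : HasDerivAt (fun t => (x, f x + (R - f x) * t)) (0, (R - f x) * 1) t :=
      (hasDerivAt_const t x).prodMk (((hasDerivAt_id t).const_mul (R - f x)).const_add (f x))
    have h3 := ((hasDerivAt_id t).const_sub 1).mul
      ((hPd (x, f x + (R - f x) * t)).hasFDerivAt.comp_hasDerivAt t h2)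
    refine h3.congr_deriv ?_
    simp only [K, Function.comp_apply]
    rw [split _ _ 0]
    simp
  have inner_eq (x : ℝ) : ∫ y in f x..R, fderiv ℝ P (x, y) (1, 0) =
      (∫ t in (0 : ℝ)..1, H (x, t)) + deriv f x * P (x, f x) := by
    have hsub := intervalIntegral.mul_integral_comp_add_mul (a := 0) (b := 1)
      (f := fun y => fderiv ℝ P (x, y) (1, 0)) (R - f x) (f x)
    have hKc : Continuous (K x) := by fun_prop
    have hK := intervalIntegral.integral_eq_sub_of_hasDerivAt (a := 0) (b := 1)
      (fun t _ => hKt x t) (hKc.intervalIntegrable _ _)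
    have hsum : (∫ t in (0 : ℝ)..1, H (x, t)) = (R - f x) *
        (∫ t in (0 : ℝ)..1, fderiv ℝ P (x, f x + (R - f x) * t) (1, 0)) +
        deriv f x * ∫ t in (0 : ℝ)..1, K x t := by
      rw [← intervalIntegral.integral_const_mul, ← intervalIntegral.integral_const_mul,
        ← intervalIntegral.integral_add (Continuous.intervalIntegrable (by fun_prop) _ _)
          (Continuous.intervalIntegrable (by fun_prop) _ _)]
      congr 1 with t
      simp only [H, K]
      ring
    rw [hsum, hK, hsub]
    simp
  simp only [inner_eq]
  have hHi : Continuous fun x => ∫ t in (0 : ℝ)..1, H (x, t) :=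
    intervalIntegral.continuous_parametric_intervalIntegral_of_continuous' (by fun_prop) _ _
  rw [intervalIntegral.integral_add (hHi.intervalIntegrable _ _)
    (Continuous.intervalIntegrable (by fun_prop) _ _),
    intervalIntegral_swap_of_continuous hH hT zero_le_one, add_eq_right]
  have hz (t : ℝ) : ∫ x in (0 : ℝ)..T, H (x, t) = 0 := by
    rw [intervalIntegral.integral_eq_sub_of_hasDerivAt (fun x _ => hHx t x)
      (Continuous.intervalIntegrable (by fun_prop) _ _)]
    simp [hfT, hPT]
  simp [hz]

/-- The divergence theorem on the periodic cell. -/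
theorem integral_divergence_OmegaR {f : ℝ → ℝ} (hf : ContDiff ℝ 1 f) (hfT : f (2 * π) = f 0)
    {R : ℝ} (hR : ∀ x ∈ Icc 0 (2 * π), f x < R) {P Q : ℝ × ℝ → ℝ} (hP : ContDiff ℝ 1 P)
    (hQ : ContDiff ℝ 1 Q) (hPT : ∀ y, P (2 * π, y) = P (0, y)) :
    ∫ x in OmegaR f R, (fderiv ℝ P x (1, 0) + fderiv ℝ Q x (0, 1)) =
      (∫ x in Ioo 0 (2 * π), Q (x, R)) -
        ∫ x in Ioo 0 (2 * π), (Q (x, f x) - deriv f x * P (x, f x)) := by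
  have hfc : Continuous f := hf.continuous
  have hPc : Continuous P := hP.continuous
  have hQc : Continuous Q := hQ.continuous
  have hf' : Continuous (deriv f) := hf.continuous_deriv le_rfl
  have hP' : Continuous (fderiv ℝ P) := hP.continuous_fderiv one_ne_zero
  have hQ' : Continuous (fderiv ℝ Q) := hQ.continuous_fderiv one_ne_zero
  have hpi : (0 : ℝ) ≤ 2 * π := by positivity
  rw [integral_add (integrableOn_OmegaR hfc R (by fun_prop))
    (integrableOn_OmegaR hfc R (by fun_prop)), integral_OmegaR hfc hR (by fun_prop),
    integral_OmegaR hfc hR (by fun_prop), integral_fderiv_fst hf hpi hfT R hP hPT]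
  simp only [integral_fderiv_snd hQ, ← integral_Ioc_eq_integral_Ioo,
    ← intervalIntegral.integral_of_le hpi]
  rw [intervalIntegral.integral_sub (Continuous.intervalIntegrable (by fun_prop) _ _)
      (Continuous.intervalIntegrable (by fun_prop) _ _),
    intervalIntegral.integral_sub (Continuous.intervalIntegrable (by fun_prop) _ _)
      (Continuous.intervalIntegrable (by fun_prop) _ _)]
  ring

theorem QP.fderiv_apply {α : ℝ} {v : ℝ × ℝ → ℂ} (h : QP α v) (hv : Differentiable ℝ v)
    (w : ℝ × ℝ) : QP α fun x => fderiv ℝ v x w := by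
  intro x
  have e : (fun x : ℝ × ℝ => v (x + (2 * π, 0))) =
      fun x => Complex.exp (((2 * π * α : ℝ) : ℂ) * Complex.I) • v x := by
    funext x
    simpa [Prod.add_def] using h x
  have := congrArg (fun u => fderiv ℝ u x w) e
  simp only [fderiv_comp_add_right, fderiv_fun_const_smul (hv x)] at this
  simpa [Prod.add_def] using this

theorem contDiff_p1 {v : ℝ × ℝ → ℂ} (hv : ContDiff ℝ 2 v) : ContDiff ℝ 1 (p1 v) :=
  (hv.fderiv_right (m := 1) (by norm_num)).clm_apply contDiff_const

theorem contDiff_p2 {v : ℝ × ℝ → ℂ} (hv : ContDiff ℝ 2 v) : ContDiff ℝ 1 (p2 v) :=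
  (hv.fderiv_right (m := 1) (by norm_num)).clm_apply contDiff_const

theorem p1_p2_comm {v : ℝ × ℝ → ℂ} (hv : ContDiff ℝ 2 v) (x : ℝ × ℝ) :
    p1 (p2 v) x = p2 (p1 v) x := by
  have hd : DifferentiableAt ℝ (fderiv ℝ v) x :=
    (hv.fderiv_right (m := 1) (by norm_num)).differentiable one_ne_zero x
  have hs : IsSymmSndFDerivAt ℝ v x := hv.contDiffAt.isSymmSndFDerivAt (by simp)
  have h1 (a : ℝ × ℝ) :
      fderiv ℝ (fun y => fderiv ℝ v y a) x = (fderiv ℝ (fderiv ℝ v) x).flip a := by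
    rw [fderiv_clm_apply hd (differentiableAt_const a)]
    simp
  change fderiv ℝ (fun y => fderiv ℝ v y (0, 1)) x (1, 0) =
    fderiv ℝ (fun y => fderiv ℝ v y (1, 0)) x (0, 1)
  rw [h1, h1]
  exact hs _ _

/-- Lemma 6.1 of the paper: the Rellich identity for an `α`-quasiperiodic
function `v`, `C²` up to the closure of `Ω_R`, where `ν = (0,1)` on `Γ_R`,
`ν = (−f′,1)/√(1+f′²)` on `Γ`, and integrals over `Γ` carry the arclength weight `√(1+f′²)`. -/
theorem rellich_identity
    (f : ℝ → ℝ) (hfper : ∀ t, f (t + 2 * π) = f t) (hf : ContDiff ℝ 1 f)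
    (k α c : ℝ) (hk : 0 < k)
    (R : ℝ) (hR : GammaMax f < R)
    (v : ℝ × ℝ → ℂ) (hv : ContDiff ℝ 2 v) (hvqp : QP α v) :
    2 * (∫ x in OmegaR f R,
          ((x.2 - c : ℝ) : ℂ) * (starRingEnd ℂ) (p2 v x) * (lap v x + (k : ℂ) ^ 2 * v x)).re -
      ∫ x in OmegaR f R,
        (‖p1 v x‖ ^ 2 + ‖p2 v x‖ ^ 2 - k ^ 2 * ‖v x‖ ^ 2 - 2 * ‖p2 v x‖ ^ 2) =
    (∫ x₁ in Ioo (0 : ℝ) (2 * π),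
        (R - c) * (-(‖p1 v (x₁, R)‖ ^ 2 + ‖p2 v (x₁, R)‖ ^ 2) + k ^ 2 * ‖v (x₁, R)‖ ^ 2
          + 2 * ((starRingEnd ℂ) (p2 v (x₁, R)) * p2 v (x₁, R)).re)) -
      ∫ x₁ in Ioo (0 : ℝ) (2 * π),
        ((f x₁ - c) * (-(1 / Real.sqrt (1 + deriv f x₁ ^ 2)) *
              (‖p1 v (x₁, f x₁)‖ ^ 2 + ‖p2 v (x₁, f x₁)‖ ^ 2)
            + (1 / Real.sqrt (1 + deriv f x₁ ^ 2)) * k ^ 2 * ‖v (x₁, f x₁)‖ ^ 2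
            + 2 * ((starRingEnd ℂ) (p2 v (x₁, f x₁)) * dnu f v x₁).re)) *
          Real.sqrt (1 + deriv f x₁ ^ 2) := by
  have hRf : ∀ x ∈ Icc 0 (2 * π), f x < R := fun x hx =>
    (le_csSup (isCompact_Icc.bddAbove_image hf.continuous.continuousOn)
      (mem_image_of_mem f hx)).trans_lt hR
  have hfT : f (2 * π) = f 0 := by simpa using hfper 0
  have h1 := contDiff_p1 hv
  have h2 := contDiff_p2 hv
  have hv1 : ContDiff ℝ 1 v := hv.of_le one_le_two
  let P : ℝ × ℝ → ℝ := fun x => (x.2 - c) * (2 * inner ℝ (p2 v x) (p1 v x))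
  let Q : ℝ × ℝ → ℝ := fun x => (x.2 - c) *
    (inner ℝ (p2 v x) (p2 v x) - inner ℝ (p1 v x) (p1 v x) + k ^ 2 * inner ℝ (v x) (v x))
  have hP : ContDiff ℝ 1 P := by
    have := h2.inner ℝ h1
    fun_prop
  have hQ : ContDiff ℝ 1 Q := by
    have := h2.inner ℝ h2
    have := h1.inner ℝ h1
    have := hv1.inner ℝ hv1
    fun_prop
  have hPT (y : ℝ) : P (2 * π, y) = P (0, y) := by
    have e1 := hvqp.fderiv_apply (hv1.differentiable one_ne_zero) (1, 0) (0, y)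
    have e2 := hvqp.fderiv_apply (hv1.differentiable one_ne_zero) (0, 1) (0, y)
    simp only [zero_add] at e1 e2
    change p1 v _ = _ * p1 v _ at e1
    change p2 v _ = _ * p2 v _ at e2
    simp only [P, e1, e2, Complex.inner, map_mul]
    rw [mul_mul_mul_comm, Complex.mul_conj', Complex.norm_exp_ofReal_mul_I]
    simp
  have c1 := h1.continuous
  have c2 := h2.continuous
  have cv := hv.continuous
  have c11 : Continuous (p1 (p1 v)) := (h1.continuous_fderiv one_ne_zero).clm_apply continuous_const
  have c22 : Continuous (p2 (p2 v)) := (h2.continuous_fderiv one_ne_zero).clm_apply continuous_const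
  have cl : Continuous (lap v) := c11.add c22
  have key (x : ℝ × ℝ) : fderiv ℝ P x (1, 0) + fderiv ℝ Q x (0, 1) =
      2 * (((x.2 - c : ℝ) : ℂ) * (starRingEnd ℂ) (p2 v x) * (lap v x + (k : ℂ) ^ 2 * v x)).re -
        (‖p1 v x‖ ^ 2 + ‖p2 v x‖ ^ 2 - k ^ 2 * ‖v x‖ ^ 2 - 2 * ‖p2 v x‖ ^ 2) := by
    have d1 := (h1.differentiable one_ne_zero x).hasFDerivAt
    have d2 := (h2.differentiable one_ne_zero x).hasFDerivAt
    have dv := (hv1.differentiable one_ne_zero x).hasFDerivAt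
    have ds : HasFDerivAt (fun x : ℝ × ℝ => x.2 - c) (ContinuousLinearMap.snd ℝ ℝ ℝ) x :=
      hasFDerivAt_snd.sub_const c
    have hPx : HasFDerivAt P _ x := ds.mul ((d2.inner ℝ d1).const_mul 2)
    have hQx : HasFDerivAt Q _ x := ds.mul
      (((d2.inner ℝ d2).sub (d1.inner ℝ d1)).add ((dv.inner ℝ dv).const_mul (k ^ 2)))
    have e11 : fderiv ℝ (p1 v) x (1, 0) = p1 (p1 v) x := rfl
    have e12 : fderiv ℝ (p1 v) x (0, 1) = p2 (p1 v) x := rfl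
    have e21 : fderiv ℝ (p2 v) x (1, 0) = p2 (p1 v) x := p1_p2_comm hv x
    have e22 : fderiv ℝ (p2 v) x (0, 1) = p2 (p2 v) x := rfl
    have e2 : fderiv ℝ v x (0, 1) = p2 v x := rfl
    have hk2 : ((k : ℂ) ^ 2) = ((k ^ 2 : ℝ) : ℂ) := by push_cast; rfl
    rw [hPx.fderiv, hQx.fderiv, hk2]
    simp only [add_apply, smul_apply,
      sub_apply, ContinuousLinearMap.comp_apply, fderivInnerCLM_apply,
      ContinuousLinearMap.prod_apply, ContinuousLinearMap.coe_snd', e11, e12, e21, e22, e2,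
      Complex.inner, smul_eq_mul, lap, ← Complex.normSq_eq_norm_sq, Complex.normSq_apply,
      Complex.mul_re, Complex.mul_im, Complex.add_re, Complex.add_im, Complex.conj_re,
      Complex.conj_im, Complex.ofReal_re, Complex.ofReal_im]
    ring
  have hdiv := integral_divergence_OmegaR hf hfT hRf hP hQ hPT
  have cA : Continuous fun x : ℝ × ℝ =>
      ((x.2 - c : ℝ) : ℂ) * (starRingEnd ℂ) (p2 v x) * (lap v x + (k : ℂ) ^ 2 * v x) := by
    fun_prop
  have iA := integrableOn_OmegaR hf.continuous R cA
  have hre := Complex.reCLM.integral_comp_comm iA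
  simp only [Complex.reCLM_apply] at hre
  simp only [key] at hdiv
  rw [integral_sub (integrableOn_OmegaR hf.continuous R (by fun_prop))
    (integrableOn_OmegaR hf.continuous R (by fun_prop)), integral_const_mul, hre] at hdiv
  rw [hdiv]
  congr 1
  · congr 1 with x
    simp only [Q, Complex.inner, ← Complex.normSq_eq_norm_sq, Complex.normSq_apply,
      Complex.mul_re, Complex.conj_re, Complex.conj_im]
    ring
  · congr 1 with x
    have hs : 0 < √(1 + deriv f x ^ 2) := Real.sqrt_pos.2 (by positivity)
    simp only [P, Q, dnu, Complex.inner, ← Complex.normSq_eq_norm_sq, Complex.normSq_apply,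
      Complex.mul_re, Complex.mul_im, Complex.add_re, Complex.add_im, Complex.div_ofReal_re,
      Complex.div_ofReal_im, Complex.conj_re, Complex.conj_im, Complex.ofReal_re,
      Complex.ofReal_im]
    field_simp
    ring
end
end

section
/- Let u^s(x) = Σ_{n∈ℤ} u_n e^{i(α_n x₁ + β_n x₂)} be an α-quasiperiodic outgoing Rayleigh expansion and w(x) = Σ_{n∈ℤ} w_n e^{i(α̂_n x₁ + β̂_n x₂)} a (−α)-quasiperiodic outgoing Rayleigh expansion (coefficients (u_n), (w_n) decaying fast enough that both series and their term-by-term x₂-derivatives converge absolutely at height R). Then the bilinear boundary term on Γ_R vanishes: ∫₀^{2π} ( ∂₂w(x₁,R)·u^s(x₁,R) − ∂₂u^s(x₁,R)·w(x₁,R) ) dx₁ = 0. -/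
open MeasureTheory Real Set

noncomputable section

/-- The coefficients `β` of the quasiperiodicities `α` and `-α` are exchanged by `n ↦ -n`. -/
lemma betan_neg_neg (k α : ℝ) (n : ℤ) : betan k (-α) (-n) = betan k α n := by
  have h : ((-n : ℤ) : ℝ) + -α = -((n : ℝ) + α) := by push_cast; ring
  simp only [betan, h, abs_neg, neg_sq]

lemma norm_mul_exp_I_mul_ofReal (c : ℂ) (t : ℝ) :
    ‖c * Complex.exp (Complex.I * (t : ℂ))‖ = ‖c‖ := by
  rw [norm_mul, Complex.norm_exp_I_mul_ofReal, mul_one]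

/-- A quasiperiodic Fourier series with absolutely summable coefficients is continuous. -/
lemma continuous_quasiperiodic_series {a : ℤ → ℂ} (ha : Summable fun n => ‖a n‖) (s : ℝ) :
    Continuous fun x : ℝ =>
      ∑' n : ℤ, a n * Complex.exp (Complex.I * ((((n : ℝ) + s) * x : ℝ) : ℂ)) :=
  continuous_tsum (fun n => by fun_prop) ha fun n x => (norm_mul_exp_I_mul_ofReal _ _).le

lemma integral_exp_I_int_mul {m : ℤ} (hm : m ≠ 0) :
    ∫ x in Ioo (0 : ℝ) (2 * π), Complex.exp (Complex.I * (m : ℂ) * (x : ℂ)) = 0 := by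
  rw [← integral_Ioc_eq_integral_Ioo, ← intervalIntegral.integral_of_le (by positivity),
    integral_exp_mul_complex (mul_ne_zero Complex.I_ne_zero (by exact_mod_cast hm))]
  have h : Complex.I * (m : ℂ) * ((2 * π : ℝ) : ℂ) = m * (2 * π * Complex.I) := by
    push_cast; ring
  rw [h, Complex.exp_int_mul_two_pi_mul_I]
  simp

/-- The integral over one period of the product of a `(-α)`- and an `α`-quasiperiodic
Fourier series. -/
lemma integral_quasiperiodic_series_mul {a b : ℤ → ℂ} (ha : Summable fun n => ‖a n‖)
    (hb : Summable fun n => ‖b n‖) (α : ℝ) :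
    ∫ x in Ioo (0 : ℝ) (2 * π),
      (∑' n : ℤ, a n * Complex.exp (Complex.I * ((((n : ℝ) + -α) * x : ℝ) : ℂ))) *
        ∑' n : ℤ, b n * Complex.exp (Complex.I * ((((n : ℝ) + α) * x : ℝ) : ℂ)) =
      ∑' p : ℤ × ℤ, a p.1 * b p.2 *
        ∫ x in Ioo (0 : ℝ) (2 * π),
          Complex.exp (Complex.I * ((p.1 + p.2 : ℤ) : ℂ) * (x : ℂ)) := by
  have hprod (x : ℝ) :
      (∑' n : ℤ, a n * Complex.exp (Complex.I * ((((n : ℝ) + -α) * x : ℝ) : ℂ))) *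
        ∑' n : ℤ, b n * Complex.exp (Complex.I * ((((n : ℝ) + α) * x : ℝ) : ℂ)) =
      ∑' p : ℤ × ℤ, a p.1 * b p.2 *
        Complex.exp (Complex.I * ((p.1 + p.2 : ℤ) : ℂ) * (x : ℂ)) := by
    rw [tsum_mul_tsum_of_summable_norm (by simpa only [norm_mul_exp_I_mul_ofReal] using ha)
      (by simpa only [norm_mul_exp_I_mul_ofReal] using hb)]
    refine tsum_congr fun p => ?_
    rw [mul_mul_mul_comm, ← Complex.exp_add]
    congr 2
    push_cast
    ring
  have hnorm (p : ℤ × ℤ) (x : ℝ) :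
      ‖a p.1 * b p.2 * Complex.exp (Complex.I * ((p.1 + p.2 : ℤ) : ℂ) * (x : ℂ))‖ =
        ‖a p.1 * b p.2‖ := by
    rw [← norm_mul_exp_I_mul_ofReal (a p.1 * b p.2) ((p.1 + p.2 : ℤ) * x)]
    push_cast
    rw [mul_assoc Complex.I]
  simp_rw [hprod, ← integral_const_mul]
  refine (integral_tsum_of_summable_integral_norm (fun p => ?_) ?_).symm
  · exact (Continuous.integrableOn_Icc (by fun_prop)).mono_set Ioo_subset_Icc_self
  · simp_rw [hnorm, setIntegral_const]
    exact (summable_mul_of_summable_norm ha hb).norm.const_smul _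

/-- equation (4.20) of the paper: the bilinear boundary term on `Γ_R` between
an `α`-quasiperiodic outgoing Rayleigh expansion `u^s` and a `(−α)`-quasiperiodic outgoing
Rayleigh expansion `w` vanishes. -/
theorem boundary_bilinear_term_vanishes
    (k α R : ℝ) (hk : 0 < k)
    (uc wc : ℤ → ℂ)
    (hu1 : Summable (fun n : ℤ => ‖uc n * Complex.exp (Complex.I * betan k α n * (R : ℂ))‖))
    (hu2 : Summable (fun n : ℤ =>
      ‖betan k α n‖ * ‖uc n * Complex.exp (Complex.I * betan k α n * (R : ℂ))‖))
    (hw1 : Summable (fun n : ℤ => ‖wc n * Complex.exp (Complex.I * betan k (-α) n * (R : ℂ))‖))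
    (hw2 : Summable (fun n : ℤ =>
      ‖betan k (-α) n‖ * ‖wc n * Complex.exp (Complex.I * betan k (-α) n * (R : ℂ))‖)) :
    (∫ x₁ in Ioo (0 : ℝ) (2 * π),
      ((∑' n : ℤ, Complex.I * betan k (-α) n * wc n *
          Complex.exp (Complex.I * ((((n : ℝ) - α) * x₁ : ℝ) : ℂ)
            + Complex.I * betan k (-α) n * (R : ℂ))) *
        (∑' n : ℤ, uc n * Complex.exp (Complex.I * ((((n : ℝ) + α) * x₁ : ℝ) : ℂ)
            + Complex.I * betan k α n * (R : ℂ))) -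
       (∑' n : ℤ, Complex.I * betan k α n * uc n *
          Complex.exp (Complex.I * ((((n : ℝ) + α) * x₁ : ℝ) : ℂ)
            + Complex.I * betan k α n * (R : ℂ))) *
        (∑' n : ℤ, wc n * Complex.exp (Complex.I * ((((n : ℝ) - α) * x₁ : ℝ) : ℂ)
            + Complex.I * betan k (-α) n * (R : ℂ))))) = 0 := by
  have hw0 : Summable fun n : ℤ =>
      ‖Complex.I * betan k (-α) n * wc n * Complex.exp (Complex.I * betan k (-α) n * (R : ℂ))‖ := by
    simpa only [mul_assoc, norm_mul, Complex.norm_I, one_mul] using hw2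
  have hu0 : Summable fun n : ℤ =>
      ‖Complex.I * betan k α n * uc n * Complex.exp (Complex.I * betan k α n * (R : ℂ))‖ := by
    simpa only [mul_assoc, norm_mul, Complex.norm_I, one_mul] using hu2
  have split (c z w : ℂ) :
      c * Complex.exp (z + w) = c * Complex.exp w * Complex.exp z := by
    rw [Complex.exp_add]; ring
  have integrable {f g : ℝ → ℂ} (hf : Continuous f) (hg : Continuous g) :
      Integrable (fun x => f x * g x) (volume.restrict (Ioo 0 (2 * π))) :=
    (hf.mul hg).integrableOn_Icc.mono_set Ioo_subset_Icc_self
  simp only [split, sub_eq_add_neg (_ : ℝ) α]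
  rw [integral_sub
    (integrable (continuous_quasiperiodic_series hw0 _)
      (continuous_quasiperiodic_series hu1 _))
    (integrable (continuous_quasiperiodic_series hu0 _)
      (continuous_quasiperiodic_series hw1 _)), sub_eq_zero]
  simp_rw [mul_comm (∑' n : ℤ, Complex.I * betan k α n * uc n * _ * _)]
  rw [integral_quasiperiodic_series_mul hw0 hu1, integral_quasiperiodic_series_mul hw1 hu0]
  refine tsum_congr fun ⟨n, m⟩ => ?_
  by_cases h : n + m = 0
  · obtain rfl : n = -m := by lia
    simp only [betan_neg_neg]
    ring
  · simp only [integral_exp_I_int_mul h, mul_zero]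
end
end

section
/- Let u^i(x) = γ e^{i(αx₁ − βx₂)} with γ ∈ ℂ, α = k sin θ, β = k cos θ, and let w(x) = Σ_{n∈ℤ} w_n e^{i(α̂_n x₁ + β̂_n x₂)} be a (−α)-quasiperiodic outgoing Rayleigh expansion (with coefficients decaying fast enough that the series and its term-by-term x₂-derivative converge absolutely at height R). Then | ∫₀^{2π} ( ∂₂w(x₁,R)·u^i(x₁,R) − ∂₂u^i(x₁,R)·w(x₁,R) ) dx₁ | = 4πk·cos θ·|w₀|·|γ|. -/
open MeasureTheory Real Set

noncomputable section

theorem integral_Ioo_exp_I_int_mul (n : ℤ) :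
    ∫ x in Ioo (0 : ℝ) (2 * π), Complex.exp (Complex.I * (((n : ℝ) * x : ℝ) : ℂ)) =
      if n = 0 then ((2 * π : ℝ) : ℂ) else 0 := by
  rw [← integral_Ioc_eq_integral_Ioo, ← intervalIntegral.integral_of_le (by positivity)]
  split_ifs with h
  · simp [h]
  · have hc : Complex.I * (n : ℂ) ≠ 0 := mul_ne_zero Complex.I_ne_zero (by exact_mod_cast h)
    have hexp : Complex.exp (Complex.I * n * ((2 * π : ℝ) : ℂ)) = 1 := by
      rw [Complex.exp_eq_one_iff]
      exact ⟨n, by push_cast; ring⟩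
    have := integral_exp_mul_complex (a := 0) (b := 2 * π) hc
    rw [hexp] at this
    simpa [mul_assoc] using this

/-- An absolutely summable Fourier series integrates over a period to its zeroth coefficient. -/
theorem integral_Ioo_tsum_mul_exp_I_int_mul {a : ℤ → ℂ} (ha : Summable fun n => ‖a n‖) :
    ∫ x in Ioo (0 : ℝ) (2 * π), ∑' n : ℤ, a n * Complex.exp (Complex.I * (((n : ℝ) * x : ℝ) : ℂ)) =
      ((2 * π : ℝ) : ℂ) * a 0 := by
  have hnorm (n : ℤ) (x : ℝ) :
      ‖a n * Complex.exp (Complex.I * (((n : ℝ) * x : ℝ) : ℂ))‖ = ‖a n‖ := by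
    rw [norm_mul, Complex.norm_exp_I_mul_ofReal, mul_one]
  have hcont (n : ℤ) :
      Continuous fun x : ℝ => a n * Complex.exp (Complex.I * (((n : ℝ) * x : ℝ) : ℂ)) := by
    fun_prop
  have hsum := hasSum_integral_of_dominated_convergence
    (μ := volume.restrict (Ioo (0 : ℝ) (2 * π)))
    (F := fun n x => a n * Complex.exp (Complex.I * (((n : ℝ) * x : ℝ) : ℂ)))
    (fun n _ => ‖a n‖) (fun n => (hcont n).aestronglyMeasurable)
    (fun n => .of_forall fun x => (hnorm n x).le) (.of_forall fun _ => ha)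
    (integrable_const _)
    (.of_forall fun x => (Summable.of_norm (by simpa only [hnorm] using ha)).hasSum)
  rw [← hsum.tsum_eq]
  simp_rw [integral_const_mul, integral_Ioo_exp_I_int_mul]
  rw [tsum_eq_single 0 (fun n hn => by simp [hn])]
  simp [mul_comm]

theorem betan_neg_mul_sin_zero {k θ : ℝ} (hk : 0 ≤ k) (hθ : 0 ≤ Real.cos θ) :
    betan k (-(k * Real.sin θ)) 0 = ((k * Real.cos θ : ℝ) : ℂ) := by
  have habs : |((0 : ℤ) : ℝ) + -(k * Real.sin θ)| ≤ k := by
    rw [Int.cast_zero, zero_add, abs_neg, abs_mul, abs_of_nonneg hk]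
    exact mul_le_of_le_one_right hk (abs_sin_le_one θ)
  have hsq : k ^ 2 - (((0 : ℤ) : ℝ) + -(k * Real.sin θ)) ^ 2 = (k * Real.cos θ) ^ 2 := by
    push_cast
    linear_combination -k ^ 2 * Real.sin_sq_add_cos_sq θ
  rw [betan, if_pos habs, hsq, Real.sqrt_sq (by positivity)]

/-- equation (4.21) of the paper: the bilinear boundary term on `Γ_R` between
a `(−α)`-quasiperiodic outgoing Rayleigh expansion `w` and the incident wave
`u^i = γ e^{i(αx₁ − βx₂)}` has modulus `4πk cos θ |w₀| |γ|`.  Here `∂₂u^i = −iβ u^i`. -/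
theorem boundary_incident_term_modulus
    (k θ R : ℝ) (hk : 0 < k) (hθ : θ ∈ Ioo (-(π / 2)) (π / 2)) (γ : ℂ)
    (wc : ℤ → ℂ)
    (hw1 : Summable (fun n : ℤ =>
      ‖wc n * Complex.exp (Complex.I * betan k (-(k * Real.sin θ)) n * (R : ℂ))‖))
    (hw2 : Summable (fun n : ℤ => ‖betan k (-(k * Real.sin θ)) n‖ *
      ‖wc n * Complex.exp (Complex.I * betan k (-(k * Real.sin θ)) n * (R : ℂ))‖)) :
    ‖∫ x₁ in Ioo (0 : ℝ) (2 * π),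
      ((∑' n : ℤ, Complex.I * betan k (-(k * Real.sin θ)) n * wc n *
          Complex.exp (Complex.I * ((((n : ℝ) - k * Real.sin θ) * x₁ : ℝ) : ℂ)
            + Complex.I * betan k (-(k * Real.sin θ)) n * (R : ℂ))) *
        ui k θ γ (x₁, R) -
       (-(Complex.I) * ((k * Real.cos θ : ℝ) : ℂ) * ui k θ γ (x₁, R)) *
        (∑' n : ℤ, wc n *
          Complex.exp (Complex.I * ((((n : ℝ) - k * Real.sin θ) * x₁ : ℝ) : ℂ)
            + Complex.I * betan k (-(k * Real.sin θ)) n * (R : ℂ))))‖ =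
      4 * π * k * Real.cos θ * ‖wc 0‖ * ‖γ‖ := by
  have hcos : 0 < Real.cos θ := cos_pos_of_mem_Ioo hθ
  set b : ℤ → ℂ := betan k (-(k * Real.sin θ))
  have hb0 : b 0 = ((k * Real.cos θ : ℝ) : ℂ) := betan_neg_mul_sin_zero hk.le hcos.le
  set β : ℂ := ((k * Real.cos θ : ℝ) : ℂ) with hβ
  set d : ℤ → ℂ := fun n => wc n * Complex.exp (Complex.I * b n * (R : ℂ)) with hd
  set a : ℤ → ℂ := fun n =>
    (Complex.I * γ * Complex.exp (-(Complex.I * β * R))) * ((b n + β) * d n) with ha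
  have hd1 : Summable d := hw1.of_norm
  have hbd : Summable fun n => ‖b n * d n‖ := hw2.congr fun n => (norm_mul _ _).symm
  have hasum : Summable fun n => ‖a n‖ := by
    refine Summable.norm (Summable.mul_left _ ?_)
    simp_rw [add_mul]
    exact hbd.of_norm.add (hd1.mul_left β)
  have hphase (n : ℤ) (x : ℝ) :
      ‖Complex.exp (Complex.I * ((((n : ℝ) - k * Real.sin θ) * x : ℝ) : ℂ))‖ = 1 :=
    Complex.norm_exp_I_mul_ofReal _
  have hintegrand (x : ℝ) :
      (∑' n : ℤ, Complex.I * b n * wc n *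
          Complex.exp (Complex.I * ((((n : ℝ) - k * Real.sin θ) * x : ℝ) : ℂ)
            + Complex.I * b n * (R : ℂ))) * ui k θ γ (x, R) -
        (-(Complex.I) * β * ui k θ γ (x, R)) *
        (∑' n : ℤ, wc n *
          Complex.exp (Complex.I * ((((n : ℝ) - k * Real.sin θ) * x : ℝ) : ℂ)
            + Complex.I * b n * (R : ℂ))) =
      ∑' n : ℤ, a n * Complex.exp (Complex.I * (((n : ℝ) * x : ℝ) : ℂ)) := by
    have hs1 : Summable fun n : ℤ => Complex.I * b n * wc n *
        Complex.exp (Complex.I * ((((n : ℝ) - k * Real.sin θ) * x : ℝ) : ℂ)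
          + Complex.I * b n * (R : ℂ)) := by
      refine Summable.of_norm (hbd.congr fun n => ?_)
      simp only [hd, Complex.exp_add, norm_mul, hphase, Complex.norm_I]
      ring
    have hs2 : Summable fun n : ℤ => wc n *
        Complex.exp (Complex.I * ((((n : ℝ) - k * Real.sin θ) * x : ℝ) : ℂ)
          + Complex.I * b n * (R : ℂ)) := by
      refine Summable.of_norm (hw1.congr fun n => ?_)
      simp only [Complex.exp_add, norm_mul, hphase, one_mul]
    rw [← tsum_mul_right, ← tsum_mul_left,
      ← (hs1.mul_right _).tsum_sub (hs2.mul_left _)]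
    refine tsum_congr fun n => ?_
    have hexp : Complex.exp (Complex.I * ((((n : ℝ) - k * Real.sin θ) * x : ℝ) : ℂ)) *
        Complex.exp (Complex.I * ((k * Real.sin θ * x - k * Real.cos θ * R : ℝ) : ℂ)) =
        Complex.exp (-(Complex.I * β * R)) *
          Complex.exp (Complex.I * (((n : ℝ) * x : ℝ) : ℂ)) := by
      rw [← Complex.exp_add, ← Complex.exp_add, hβ]
      congr 1
      push_cast
      ring
    simp only [ui, ha, hd, Complex.exp_add]
    linear_combination (Complex.I * γ * (b n + β) * wc n *
      Complex.exp (Complex.I * b n * R)) * hexp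
  simp_rw [hintegrand]
  have hexpR (s : ℝ) : ‖Complex.exp (Complex.I * ((k * Real.cos θ : ℝ) : ℂ) * s)‖ = 1 := by
    rw [mul_assoc, ← Complex.ofReal_mul, Complex.norm_exp_I_mul_ofReal]
  have hexpR' : ‖Complex.exp (-(Complex.I * β * R))‖ = 1 := by
    simpa [hβ] using hexpR (-R)
  have hββ : ‖β + β‖ = 2 * (k * Real.cos θ) := by
    rw [← two_mul, norm_mul, Complex.norm_two, hβ, Complex.norm_of_nonneg (by positivity)]
  rw [integral_Ioo_tsum_mul_exp_I_int_mul hasum]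
  simp only [ha, hd, hb0, norm_mul, hββ, hexpR', Complex.norm_I]
  rw [hβ, hexpR, Complex.norm_of_nonneg (by positivity)]
  ring
end
end
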